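/- For every ε > 0 there exists δ > 0 such that, for all sufficiently large primes p, for every integer N in the range p^{1/(4√e) + ε} ≤ N ≤ p, the number of integers n with 1 ≤ n ≤ N and (n|p) = −1 is at least δN. -/

import Mathlib

open Polynomial in
/-- The operator `r ↦ f ^ (k - n) * D^k (f ^ n * r)`. -/
noncomputable def stepanovOp {F : Type*} [Field F] (f : F[X]) (n : ℕ) : ℕ → F[X] →ₗ[F] F[X]
  | 0 => LinearMap.id
  | k + 1 => (LinearMap.mulLeft F f ∘ₗ derivative +
      LinearMap.mulLeft F (C (n - k : F) * derivative f)) ∘ₗ stepanovOp f n k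

section Stepanov

open Polynomial

variable {F : Type*} [Field F]

lemma stepanovOp_succ_apply (f : F[X]) (n k : ℕ) (r : F[X]) :
    stepanovOp f n (k + 1) r = f * derivative (stepanovOp f n k r) +
      C (n - k : F) * derivative f * stepanovOp f n k r := by
  simp [stepanovOp, mul_assoc]

lemma iterate_derivative_pow_mul (f : F[X]) (n k : ℕ) (hk : k ≤ n) (r : F[X]) :
    derivative^[k] (f ^ n * r) = f ^ (n - k) * stepanovOp f n k r := by
  induction k with
  | zero => simp [stepanovOp]
  | succ k ih =>
    rw [Function.iterate_succ_apply', ih (by omega), derivative_mul, derivative_pow,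
      stepanovOp_succ_apply]
    obtain ⟨j, rfl⟩ : ∃ j, n = k + 1 + j := ⟨n - (k + 1), by omega⟩
    have h1 : k + 1 + j - k = j + 1 := by omega
    have h2 : k + 1 + j - (k + 1) = j := by omega
    rw [h1, h2]
    have h3 : ((k + 1 + j : ℕ) - k : F) = ((j + 1 : ℕ) : F) := by push_cast; ring
    rw [h3, Nat.add_sub_cancel]
    ring

lemma natDegree_stepanovOp_le (f : F[X]) (n k : ℕ) (r : F[X]) :
    (stepanovOp f n k r).natDegree ≤ r.natDegree + k * f.natDegree := by
  induction k with
  | zero => simp [stepanovOp]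
  | succ k ih =>
    rw [stepanovOp_succ_apply]
    refine (natDegree_add_le _ _).trans (max_le ?_ ?_)
    · refine natDegree_mul_le.trans ?_
      have := natDegree_derivative_le (stepanovOp f n k r)
      rw [add_mul]; omega
    · refine natDegree_mul_le.trans ?_
      have := natDegree_C_mul_le (n - k : F) (derivative f)
      have := natDegree_derivative_le f
      rw [add_mul]; omega

lemma iterate_derivative_mul_X_pow_char {p : ℕ} [CharP F p] (g : F[X]) (j k : ℕ) :
    derivative^[k] (g * X ^ (j * p)) = derivative^[k] g * X ^ (j * p) := by
  induction k with
  | zero => simp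
  | succ k ih =>
    have h : derivative ((X : F[X]) ^ (j * p)) = 0 := by simp [derivative_X_pow]
    simp [Function.iterate_succ_apply', ih, derivative_mul, h]

/-- If `h₀ + h₁ f ^ ((p - 1) / 2) = 0`, where `h₀, h₁` are given by their expansions in powers of
`X ^ p` with digits of small degree, then all digits vanish unless `f` is a square up to
a constant. -/
lemma stepanov_digits_eq_zero {p : ℕ} [Fact p.Prime] (hp : p ≠ 2) (f : (ZMod p)[X])
    (hf0 : f.eval 0 ≠ 0) {α : ZMod p} (hα : Odd (f.rootMultiplicity α)) {B : ℕ}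
    (hB : 2 * B + f.natDegree ≤ p + 1) :
    ∀ (J : ℕ) (r s : ℕ → (ZMod p)[X]), (∀ j, r j ∈ degreeLT (ZMod p) B) →
      (∀ j, s j ∈ degreeLT (ZMod p) B) →
      ∑ j ∈ Finset.range J, (r j + s j * f ^ (p / 2)) * X ^ (j * p) = 0 →
      ∀ j < J, r j = 0 ∧ s j = 0 := by
  intro J
  induction J with
  | zero => intro r s _ _ _ j hj; omega
  | succ J ih =>
    intro r s hr hs hsum
    have hf : f ≠ 0 := by rintro rfl; simp at hf0
    have hp0 : p ≠ 0 := (Fact.out : p.Prime).ne_zero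
    have key : r 0 = 0 ∧ s 0 = 0 := by
      rw [Finset.sum_range_succ'] at hsum
      set h₀ := ∑ j ∈ Finset.range J, r (j + 1) * X ^ (j * p) with hh₀
      set h₁ := ∑ j ∈ Finset.range J, s (j + 1) * X ^ (j * p) with hh₁
      have e : ∑ j ∈ Finset.range J, (r (j + 1) + s (j + 1) * f ^ (p / 2)) * X ^ ((j + 1) * p)
          = X ^ p * h₀ + X ^ p * h₁ * f ^ (p / 2) := by
        simp only [hh₀, hh₁, Finset.mul_sum, Finset.sum_mul, ← Finset.sum_add_distrib]
        refine Finset.sum_congr rfl fun j _ => ?_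
        ring
      rw [e] at hsum
      simp only [zero_mul, pow_zero, mul_one] at hsum
      have hfp : f ^ (p / 2) * f ^ (p / 2) * f = f ^ p := by
        rw [← pow_add, ← pow_succ]
        congr 1
        have := (Fact.out : p.Prime).eq_two_or_odd
        omega
      have hsq : (r 0 + X ^ p * h₀) ^ 2 * f = (s 0 + X ^ p * h₁) ^ 2 * f ^ p := by
        have : r 0 + X ^ p * h₀ = -((s 0 + X ^ p * h₁) * f ^ (p / 2)) := by
          linear_combination hsum
        rw [this, ← hfp]; ring
      have hexp : f ^ p = expand (ZMod p) p f := (ZMod.expand_card f).symm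
      have hfpX : ∃ g : (ZMod p)[X], f ^ p = C (f.eval 0) + X ^ p * g := by
        have : X ∣ f - C (f.eval 0) := by
          have := dvd_iff_isRoot.2 (show IsRoot (f - C (f.eval 0)) 0 by simp)
          simpa using this
        obtain ⟨g, hg⟩ := this
        refine ⟨expand (ZMod p) p g, ?_⟩
        have h2 : f = C (f.eval 0) + X * g := by rw [← hg]; ring
        rw [hexp]
        conv_lhs => rw [h2]
        simp
      obtain ⟨g, hg⟩ := hfpX
      set c := f.eval 0
      have hdvd : X ^ p ∣ r 0 ^ 2 * f - C c * s 0 ^ 2 := by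
        refine ⟨(2 * s 0 * h₁ + X ^ p * h₁ ^ 2) * f ^ p + s 0 ^ 2 * g
          - (2 * r 0 * h₀ + X ^ p * h₀ ^ 2) * f, ?_⟩
        have h3 : r 0 ^ 2 * f = (s 0 + X ^ p * h₁) ^ 2 * f ^ p
          - (2 * r 0 * h₀ + X ^ p * h₀ ^ 2) * f * X ^ p := by rw [← hsq]; ring
        rw [h3]
        have h4 : (s 0 + X ^ p * h₁) ^ 2 * f ^ p = s 0 ^ 2 * f ^ p +
           X ^ p * ((2 * s 0 * h₁ + X ^ p * h₁ ^ 2) * f ^ p) := by ring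
        rw [h4]
        nth_rewrite 1 [hg]
        ring
      have hBd : ∀ q ∈ degreeLT (ZMod p) B, q ≠ 0 → q.natDegree + 1 ≤ B := by
        intro q hq hq0
        rw [mem_degreeLT, degree_eq_natDegree hq0] at hq
        exact_mod_cast hq
      have hc : c ≠ 0 := hf0
      have hzero : r 0 ^ 2 * f - C c * s 0 ^ 2 = 0 := by
        refine eq_zero_of_dvd_of_degree_lt hdvd ?_
        rw [degree_X_pow]
        refine (degree_sub_le _ _).trans_lt (max_lt ?_ ?_)
        · rcases eq_or_ne (r 0) 0 with h | h
          · simp [h]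
          · rw [degree_eq_natDegree (mul_ne_zero (pow_ne_zero _ h) hf),
              natDegree_mul (pow_ne_zero _ h) hf, natDegree_pow]
            have := hBd _ (hr 0) h
            exact_mod_cast (by omega)
        · rcases eq_or_ne (s 0) 0 with h | h
          · simp [h]
          · have hCs : C c ≠ 0 := by simpa using hc
            rw [degree_eq_natDegree (mul_ne_zero hCs (pow_ne_zero _ h)),
              natDegree_mul hCs (pow_ne_zero _ h), natDegree_pow, natDegree_C]
            have := hBd _ (hs 0) h
            exact_mod_cast (by omega)
      have heq : r 0 ^ 2 * f = C c * s 0 ^ 2 := sub_eq_zero.1 hzero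
      by_cases hr0 : r 0 = 0
      · refine ⟨hr0, ?_⟩
        rw [hr0] at heq
        have : C c * s 0 ^ 2 = 0 := by rw [← heq]; simp
        simpa [hc] using this
      · exfalso
        have hs0 : s 0 ≠ 0 := by
          intro h
          rw [h] at heq
          have : r 0 ^ 2 * f = 0 := by rw [heq]; simp
          simp [hr0, hf] at this
        have hCs : C c ≠ 0 := by simpa using hc
        have h5 := congrArg (rootMultiplicity α) heq
        rw [rootMultiplicity_mul (mul_ne_zero (pow_ne_zero _ hr0) hf),
          rootMultiplicity_mul (mul_ne_zero hCs (pow_ne_zero _ hs0)), rootMultiplicity_C,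
          sq, sq, rootMultiplicity_mul (mul_ne_zero hr0 hr0),
          rootMultiplicity_mul (mul_ne_zero hs0 hs0)] at h5
        obtain ⟨t, ht⟩ := hα
        omega
    have hX : ∑ j ∈ Finset.range J, (r (j + 1) + s (j + 1) * f ^ (p / 2)) * X ^ (j * p) = 0 := by
      rw [Finset.sum_range_succ'] at hsum
      have : (X : (ZMod p)[X]) ^ p *
          ∑ j ∈ Finset.range J, (r (j + 1) + s (j + 1) * f ^ (p / 2)) * X ^ (j * p) = 0 := by
        rw [Finset.mul_sum]
        rw [key.1, key.2] at hsum
        simp only [zero_mul, add_zero] at hsum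
        rw [← hsum]
        refine Finset.sum_congr rfl fun j _ => ?_
        ring
      rcases mul_eq_zero.1 this with h | h
      · simp at h
      · exact h
    have := ih (fun j => r (j + 1)) (fun j => s (j + 1)) (fun j => hr _) (fun j => hs _) hX
    intro j hj
    rcases j with _ | j
    · exact key
    · exact this j (by omega)

/-- Existence of the auxiliary digits in Stepanov's method. -/
lemma exists_stepanov_digits {K : Type*} [Field K] (f : K[X]) (a : K) (B J l n₁ n₂ : ℕ)
    (h : l * (B + J + l * f.natDegree) < 2 * (J * B)) :
    ∃ r s : ℕ → K[X], (∀ j, r j ∈ degreeLT K B) ∧ (∀ j, s j ∈ degreeLT K B) ∧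
      (∃ j < J, r j ≠ 0 ∨ s j ≠ 0) ∧
      ∀ k < l, ∑ j ∈ Finset.range J,
        (stepanovOp f n₁ k (r j) + C a * stepanovOp f n₂ k (s j)) * X ^ j = 0 := by
  classical
  set D := B + J + l * f.natDegree with hD
  let P : Fin l → (Fin J → degreeLT K B) × (Fin J → degreeLT K B) →ₗ[K] K[X] := fun k =>
    { toFun := fun v => ∑ j : Fin J,
        (stepanovOp f n₁ k (v.1 j) + C a * stepanovOp f n₂ k (v.2 j)) * X ^ (j : ℕ)
      map_add' := by
        intro v w
        rw [← Finset.sum_add_distrib]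
        refine Finset.sum_congr rfl fun j _ => ?_
        simp only [Prod.fst_add, Prod.snd_add, Pi.add_apply, Submodule.coe_add, map_add]
        ring
      map_smul' := by
        intro c v
        simp only [RingHom.id_apply]
        rw [Finset.smul_sum]
        refine Finset.sum_congr rfl fun j _ => ?_
        simp only [Prod.smul_fst, Prod.smul_snd, Pi.smul_apply, Submodule.coe_smul, map_smul]
        simp only [smul_eq_C_mul]
        ring }
  let T : (Fin J → degreeLT K B) × (Fin J → degreeLT K B) →ₗ[K] (Fin l → Fin D → K) :=
    LinearMap.pi fun k => LinearMap.pi fun i => (lcoeff K (i : ℕ)) ∘ₗ P k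
  have hker : LinearMap.ker T ≠ ⊥ := by
    apply LinearMap.ker_ne_bot_of_finrank_lt
    have e : Module.finrank K (degreeLT K B) = B := by
      rw [(degreeLTEquiv K B).finrank_eq]; simp
    have : Module.Finite K (degreeLT K B) :=
      Module.Finite.equiv (degreeLTEquiv K B).symm
    have e₁ : Module.finrank K ((Fin J → degreeLT K B) × (Fin J → degreeLT K B)) =
        2 * (J * B) := by
      rw [Module.finrank_prod, Module.finrank_pi_fintype]
      simp [e]; ring
    have e₂ : Module.finrank K (Fin l → Fin D → K) = l * D := by
      rw [Module.finrank_pi_fintype]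
      simp
    rw [e₁, e₂]
    exact h
  obtain ⟨v, hv, hv0⟩ := Submodule.exists_mem_ne_zero_of_ne_bot hker
  have hP : ∀ k, P k v = 0 := by
    intro k
    ext i
    by_cases hi : i < D
    · have := congrFun (congrFun (LinearMap.mem_ker.1 hv) k) ⟨i, hi⟩
      simpa [T] using this
    · rw [coeff_zero]
      apply coeff_eq_zero_of_natDegree_lt
      refine lt_of_lt_of_le ?_ (not_lt.1 hi)
      have hBd : ∀ q : degreeLT K B, B = 0 ∨ (q : K[X]).natDegree + 1 ≤ B := by
        intro q
        by_cases hq0 : (q : K[X]) = 0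
        · rw [hq0, natDegree_zero]; omega
        · have := q.2
          rw [mem_degreeLT, degree_eq_natDegree hq0] at this
          right; exact_mod_cast this
      have hB0 : B ≠ 0 := by rintro rfl; simp at h
      have hJ0 : J ≠ 0 := by rintro rfl; simp at h
      have : (P k v).natDegree ≤ D - 1 := by
        simp only [P, LinearMap.coe_mk, AddHom.coe_mk]
        refine natDegree_sum_le_of_forall_le _ _ fun j _ => ?_
        refine natDegree_mul_le.trans ?_
        rw [natDegree_X_pow]
        have h1 := natDegree_stepanovOp_le f n₁ k (v.1 j)
        have h2 := natDegree_stepanovOp_le f n₂ k (v.2 j)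
        have h3 := natDegree_C_mul_le a (stepanovOp f n₂ k (v.2 j))
        have h4 := natDegree_add_le (stepanovOp f n₁ k (v.1 j))
          (C a * stepanovOp f n₂ k (v.2 j))
        have h5 : (k : ℕ) * f.natDegree ≤ l * f.natDegree :=
          Nat.mul_le_mul_right _ k.2.le
        have h6 := hBd (v.1 j)
        have h7 := hBd (v.2 j)
        have h8 := j.2
        have h9 := le_trans h4 (max_le (h1.trans (by omega : _ ≤ B - 1 + l * f.natDegree))
          ((h3.trans h2).trans (by omega : _ ≤ B - 1 + l * f.natDegree)))
        omega
      omega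
  refine ⟨fun j => if hj : j < J then v.1 ⟨j, hj⟩ else 0,
    fun j => if hj : j < J then v.2 ⟨j, hj⟩ else 0, ?_, ?_, ?_, ?_⟩
  · intro j
    dsimp only
    split_ifs
    · exact (v.1 _).2
    · exact Submodule.zero_mem _
  · intro j
    dsimp only
    split_ifs
    · exact (v.2 _).2
    · exact Submodule.zero_mem _
  · by_contra! hcon
    apply hv0
    refine Prod.ext (funext fun j => ?_) (funext fun j => ?_)
    · have := (hcon j j.2).1
      simpa using this
    · have := (hcon j j.2).2
      simpa using this
  · intro k hk
    have := hP ⟨k, hk⟩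
    rw [Finset.sum_range]
    simpa [P] using this

/-- Stepanov's method with free parameters: the number of points where `f ^ ((p - 1) / 2)` takes
a given nonzero value. -/
lemma stepanov_count {p : ℕ} [Fact p.Prime] (hp : p ≠ 2) (f : (ZMod p)[X])
    (hf0 : f.eval 0 ≠ 0) {α : ZMod p} (hα : Odd (f.rootMultiplicity α)) {B J l : ℕ}
    (hB : 2 * B + f.natDegree ≤ p + 1) (hl : l ≤ p)
    (h : l * (B + J + l * f.natDegree) < 2 * (J * B)) (a : ZMod p) (ha : a ≠ 0)
    (S : Finset (ZMod p)) (hS : ∀ x ∈ S, (f.eval x) ^ (p / 2) = a) :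
    l * S.card ≤ l * f.natDegree + B + p / 2 * f.natDegree + J * p := by
  obtain ⟨r, s, hr, hs, hne, heq⟩ := exists_stepanov_digits f a B J l l (l + p / 2) h
  set R := ∑ j ∈ Finset.range J, (f ^ l * r j + f ^ (l + p / 2) * s j) * X ^ (j * p) with hR
  have hf : f ≠ 0 := by rintro rfl; simp at hf0
  have hp2 := (Fact.out : p.Prime).two_le
  have hR0 : R ≠ 0 := by
    intro h0
    have : f ^ l * ∑ j ∈ Finset.range J, (r j + s j * f ^ (p / 2)) * X ^ (j * p) = 0 := by
      rw [← h0, hR, Finset.mul_sum]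
      refine Finset.sum_congr rfl fun j _ => ?_
      ring
    have h1 := (mul_eq_zero.1 this).resolve_left (pow_ne_zero _ hf)
    obtain ⟨j, hj, hj'⟩ := hne
    have := stepanov_digits_eq_zero hp f hf0 hα hB J r s hr hs h1 j hj
    tauto
  have hroot : ∀ x ∈ S, l ≤ R.rootMultiplicity x := by
    intro x hx
    have hfx : f.eval x ≠ 0 := by
      intro h0
      have := hS x hx
      rw [h0, zero_pow (by omega)] at this
      exact ha this.symm
    have hder : ∀ k < l, (derivative^[k] R).IsRoot x := by
      intro k hk
      rw [IsRoot.def, hR, iterate_derivative_sum]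
      have e : ∀ j, derivative^[k] ((f ^ l * r j + f ^ (l + p / 2) * s j) * X ^ (j * p)) =
          f ^ (l - k) * (stepanovOp f l k (r j) +
            f ^ (p / 2) * stepanovOp f (l + p / 2) k (s j)) * X ^ (j * p) := by
        intro j
        rw [iterate_derivative_mul_X_pow_char, iterate_map_add,
          iterate_derivative_pow_mul f l k hk.le,
          iterate_derivative_pow_mul f (l + p / 2) k (by omega)]
        rw [show l + p / 2 - k = (l - k) + p / 2 by omega, pow_add]
        ring
      simp only [e, eval_finsetSum, eval_mul, eval_add, eval_pow, eval_X]
      have h2 := congrArg (eval x) (heq k hk)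
      simp only [eval_finsetSum, eval_mul, eval_add, eval_pow, eval_X, eval_C, eval_zero] at h2
      rw [hS x hx]
      have h3 : ∀ j, x ^ (j * p) = x ^ j := by
        intro j
        rw [pow_mul, ZMod.pow_card]
      simp only [h3, mul_assoc]
      rw [← Finset.mul_sum]
      rw [h2, mul_zero]
    rcases Nat.eq_zero_or_pos l with rfl | hlpos
    · exact Nat.zero_le _
    have := lt_rootMultiplicity_of_isRoot_iterate_derivative_of_mem_nonZeroDivisors
      (p := R) (t := x) (n := l - 1) hR0 (fun m hm => hder m (by omega)) (by
        rw [mem_nonZeroDivisors_iff_ne_zero]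
        intro h0
        rw [ZMod.natCast_eq_zero_iff, (Fact.out : p.Prime).dvd_factorial] at h0
        omega)
    omega
  have hcard : l * S.card ≤ R.natDegree := by
    have h1 : ∑ x ∈ S, R.rootMultiplicity x ≤ Multiset.card R.roots := by
      simp only [← count_roots]
      rw [← Multiset.sum_count_eq_card (s := Finset.univ) (fun a _ => Finset.mem_univ a)]
      exact Finset.sum_le_univ_sum_of_nonneg fun x => Nat.zero_le _
    calc l * S.card = ∑ x ∈ S, l := by rw [Finset.sum_const, smul_eq_mul, mul_comm]
      _ ≤ ∑ x ∈ S, R.rootMultiplicity x := Finset.sum_le_sum hroot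
      _ ≤ _ := h1.trans (card_roots' R)
  refine hcard.trans (natDegree_sum_le_of_forall_le _ _ fun j hj => ?_)
  refine natDegree_mul_le.trans ?_
  rw [natDegree_X_pow]
  have hBd : ∀ q ∈ degreeLT (ZMod p) B, q.natDegree ≤ B := by
    intro q hq
    by_cases hq0 : q = 0
    · simp [hq0]
    · rw [mem_degreeLT, degree_eq_natDegree hq0] at hq
      have : q.natDegree < B := by exact_mod_cast hq
      omega
  have h1 : (f ^ l * r j).natDegree ≤ l * f.natDegree + B :=
    natDegree_mul_le.trans (add_le_add natDegree_pow_le (hBd _ (hr j)))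
  have h2 : (f ^ (l + p / 2) * s j).natDegree ≤ (l + p / 2) * f.natDegree + B :=
    natDegree_mul_le.trans (add_le_add natDegree_pow_le (hBd _ (hs j)))
  have h3 := natDegree_add_le (f ^ l * r j) (f ^ (l + p / 2) * s j)
  rw [add_mul] at h2
  have h4 : j * p ≤ J * p := Nat.mul_le_mul_right _ (Finset.mem_range.1 hj).le
  have h5 := h3.trans (max_le (h1.trans (Nat.le_add_right _ (p / 2 * f.natDegree)))
    (h2.trans (by omega)))
  omega

end Stepanov

section Weil

open Polynomial

lemma exists_stepanov_parameters {p m : ℕ} (hpm : 16 * (m + 2) ^ 2 ≤ p) :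
    ∃ t B : ℕ, 2 * B + m ≤ p + 1 ∧ 2 * t ≤ p ∧ p ≤ (2 * t + 2) ^ 2 ∧
      2 * t * (B + (t + m + 2) + 2 * t * m) < 2 * ((t + m + 2) * B) := by
  obtain ⟨s, hs⟩ : ∃ s, s = Nat.sqrt p := ⟨_, rfl⟩
  have hs1 : s ^ 2 ≤ p := hs ▸ Nat.sqrt_le' p
  have hs2 : p < (s + 1) ^ 2 := hs ▸ Nat.lt_succ_sqrt' p
  have hs4 : 4 * (m + 2) ≤ s := by
    rw [hs, Nat.le_sqrt']
    calc (4 * (m + 2)) ^ 2 = 16 * (m + 2) ^ 2 := by ring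
      _ ≤ p := hpm
  obtain ⟨t, ht⟩ : ∃ t, t = s / 2 := ⟨_, rfl⟩
  have ht1 : 2 * t ≤ s := by omega
  have ht2 : s ≤ 2 * t + 1 := by omega
  obtain ⟨B, hB⟩ : ∃ B, B = (p + 1 - m) / 2 := ⟨_, rfl⟩
  have hss : s ≤ s ^ 2 := by rw [pow_two]; exact Nat.le_mul_of_pos_left _ (by omega)
  have hB1 : 2 * B + m ≤ p + 1 := by omega
  have hB2 : p ≤ 2 * B + m := by omega
  have h4t : (2 * t) ^ 2 ≤ p := (Nat.pow_le_pow_left ht1 2).trans hs1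
  have hsp : 4 * (m + 2) * s ≤ p := by
    calc 4 * (m + 2) * s ≤ s * s := Nat.mul_le_mul_right _ hs4
      _ ≤ p := by rwa [pow_two] at hs1
  have hsp2 : (s + 1) ^ 2 ≤ (2 * t + 2) ^ 2 := Nat.pow_le_pow_left (by omega) 2
  refine ⟨t, B, hB1, by omega, by omega, ?_⟩
  · have e1 : 2 * t * (B + (t + m + 2) + 2 * t * m) =
        2 * (t * B) + (2 * t) * t + (m + 2) * (2 * t) + (2 * t) ^ 2 * m := by ring
    have e2 : 2 * ((t + m + 2) * B) = 2 * (t * B) + (m + 2) * (2 * B) := by ring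
    rw [e1, e2]
    have h1 : (2 * t) ^ 2 * m ≤ p * m := Nat.mul_le_mul_right _ h4t
    have h2 : 2 * ((2 * t) * t) ≤ p := by
      have : 2 * ((2 * t) * t) = (2 * t) ^ 2 := by ring
      omega
    have h3 : 4 * ((m + 2) * (2 * t)) ≤ p := by
      have : (m + 2) * (2 * t) ≤ (m + 2) * s := Nat.mul_le_mul_left _ ht1
      have e : 4 * (m + 2) * s = 4 * ((m + 2) * s) := by ring
      omega
    have h4 : (m + 2) * p ≤ (m + 2) * (2 * B + m) := Nat.mul_le_mul_left _ hB2
    have e4 : (m + 2) * (2 * B + m) = (m + 2) * (2 * B) + (m + 2) * m := by ring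
    have e5 : (m + 2) * p = p * m + 2 * p := by ring
    have h5 : 16 * ((m + 2) * m) ≤ p := by
      refine le_trans ?_ hpm
      rw [pow_two]
      exact Nat.mul_le_mul_left _ (Nat.mul_le_mul_left _ (by omega))
    omega

lemma le_of_stepanov_bound {p m t B h n q : ℝ} (hq : q ^ 2 = p) (hq1 : 1 ≤ q) (hm : 0 ≤ m)
    (ht : q / 2 ≤ 2 * t) (hB : B ≤ (p + 1) / 2) (hh : h ≤ p / 2)
    (hn : 2 * t * n ≤ 2 * t * m + B + h * m + (t + m + 2) * p) :
    n ≤ p / 2 + (4 * m + 6) * q := by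
  have hp : 1 ≤ p := by rw [← hq]; exact one_le_pow₀ hq1
  have hhm : h * m ≤ p / 2 * m := mul_le_mul_of_nonneg_right hh hm
  have h1 : q / 2 * ((3 * m + 6) * q) ≤ 2 * t * ((3 * m + 6) * q) :=
    mul_le_mul_of_nonneg_right ht (by positivity)
  have h2 : q / 2 * ((3 * m + 6) * q) = p * (3 / 2 * m + 3) := by rw [← hq]; ring
  have h3 : 2 * t * n ≤ 2 * t * (p / 2 + m + (3 * m + 6) * q) := by linarith
  have h4 := le_of_mul_le_mul_left h3 (by linarith)
  have h5 : m ≤ m * q := le_mul_of_one_le_right hm hq1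
  linarith

lemma stepanov_card_le {p : ℕ} [Fact p.Prime] (hp : p ≠ 2) (f : (ZMod p)[X])
    (hf0 : f.eval 0 ≠ 0) {α : ZMod p} (hα : Odd (f.rootMultiplicity α))
    (hpm : 16 * (f.natDegree + 2) ^ 2 ≤ p) (a : ZMod p) (ha : a ≠ 0)
    (S : Finset (ZMod p)) (hS : ∀ x ∈ S, (f.eval x) ^ (p / 2) = a) :
    (S.card : ℝ) ≤ p / 2 + (4 * f.natDegree + 6) * √p := by
  obtain ⟨t, B, hB1, htp, ht1, hlt⟩ := exists_stepanov_parameters hpm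
  have key := stepanov_count hp f hf0 hα (B := B) (J := t + f.natDegree + 2) (l := 2 * t) hB1
    htp hlt a ha S hS
  have hsq : √(p : ℝ) ^ 2 = p := Real.sq_sqrt (Nat.cast_nonneg p)
  have hs5 : √(p : ℝ) ≤ 2 * t + 2 := by
    rw [Real.sqrt_le_left (by positivity)]
    exact_mod_cast ht1
  have hs6 : (4 * (f.natDegree + 2) : ℝ) ≤ √p := by
    apply Real.le_sqrt_of_sq_le
    have : (16 * (f.natDegree + 2) ^ 2 : ℝ) ≤ p := by exact_mod_cast hpm
    rw [mul_pow]
    norm_num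
    exact this
  have hm0 : (0 : ℝ) ≤ f.natDegree := Nat.cast_nonneg _
  have hB3 : (B : ℝ) ≤ (p + 1) / 2 := by
    have : (2 * B + f.natDegree : ℝ) ≤ p + 1 := by exact_mod_cast hB1
    linarith
  refine le_of_stepanov_bound (t := t) (B := B) (h := (p / 2 : ℕ)) hsq (by linarith) hm0
    (by linarith) hB3 Nat.cast_div_le ?_
  exact_mod_cast key

lemma abs_sum_quadraticChar_le_of_eval_zero {p : ℕ} [Fact p.Prime] (hp : p ≠ 2) (f : (ZMod p)[X])
    (hf0 : f.eval 0 ≠ 0) {α : ZMod p} (hα : Odd (f.rootMultiplicity α))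
    (hpm : 16 * (f.natDegree + 2) ^ 2 ≤ p) :
    |((∑ x : ZMod p, quadraticChar (ZMod p) (f.eval x) : ℤ) : ℝ)| ≤
      (9 * f.natDegree + 12) * √p := by
  classical
  set χ := quadraticChar (ZMod p)
  have hf : f ≠ 0 := by rintro rfl; simp at hf0
  have hchar : ringChar (ZMod p) ≠ 2 := by rwa [ZMod.ringChar_zmod_n]
  have hpow : ∀ b : ZMod p, ((χ b : ℤ) : ZMod p) = b ^ (p / 2) := by
    intro b
    have := quadraticChar_eq_pow_of_char_ne_two' hchar b
    rwa [ZMod.card] at this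
  set P := Finset.univ.filter fun x : ZMod p => χ (f.eval x) = 1 with hP
  set M := Finset.univ.filter fun x : ZMod p => χ (f.eval x) = -1 with hM
  set Z := Finset.univ.filter fun x : ZMod p => f.eval x = 0 with hZ
  have c1 : (P.card : ℝ) ≤ p / 2 + (4 * f.natDegree + 6) * √p := by
    refine stepanov_card_le hp f hf0 hα hpm 1 one_ne_zero P fun x hx => ?_
    rw [← hpow, (Finset.mem_filter.1 hx).2]; simp
  have c2 : (M.card : ℝ) ≤ p / 2 + (4 * f.natDegree + 6) * √p := by
    refine stepanov_card_le hp f hf0 hα hpm (-1) (by simp) M fun x hx => ?_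
    rw [← hpow, (Finset.mem_filter.1 hx).2]; simp
  have c3 : Z.card ≤ f.natDegree := by
    have : Z ⊆ f.roots.toFinset := by
      intro x hx
      rw [Multiset.mem_toFinset, mem_roots hf]
      exact (Finset.mem_filter.1 hx).2
    exact (Finset.card_le_card this).trans ((Multiset.toFinset_card_le _).trans (card_roots' f))
  have hval : ∀ x : ZMod p, χ (f.eval x) =
      (if χ (f.eval x) = 1 then 1 else 0) - (if χ (f.eval x) = -1 then 1 else 0) ∧
      (1 : ℤ) = (if χ (f.eval x) = 1 then 1 else 0) + (if χ (f.eval x) = -1 then 1 else 0)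
        + (if f.eval x = 0 then 1 else 0) := by
    intro x
    by_cases h0 : f.eval x = 0
    · simp [h0, χ]
    · rcases quadraticChar_dichotomy h0 with h | h
      · simp [χ, h, h0]
      · simp [χ, h, h0]
  have s1 : ∑ x : ZMod p, χ (f.eval x) = P.card - M.card := by
    rw [Finset.sum_congr rfl fun x _ => (hval x).1, Finset.sum_sub_distrib]
    simp [hP, hM]
  have s2 : (p : ℤ) = P.card + M.card + Z.card := by
    have : ∑ x : ZMod p, (1 : ℤ) = p := by simp
    rw [← this, Finset.sum_congr rfl fun x _ => (hval x).2, Finset.sum_add_distrib,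
      Finset.sum_add_distrib]
    simp [hP, hM, hZ]
  have s2' : (p : ℝ) = P.card + M.card + Z.card := by exact_mod_cast s2
  have c3' : (Z.card : ℝ) ≤ f.natDegree := by exact_mod_cast c3
  have hq : 1 ≤ √(p : ℝ) := by
    rw [Real.one_le_sqrt]; exact_mod_cast (Fact.out : p.Prime).one_lt.le
  have hm0 : (0 : ℝ) ≤ f.natDegree := Nat.cast_nonneg _
  have hz0 : (0 : ℝ) ≤ Z.card := Nat.cast_nonneg _
  have hmq : (f.natDegree : ℝ) ≤ f.natDegree * √p := le_mul_of_one_le_right hm0 hq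
  rw [s1, abs_le]
  push_cast
  constructor <;> nlinarith

/-- The Weil bound (with a non-optimal constant) for the quadratic character of a polynomial having
a root of odd multiplicity. -/
theorem abs_sum_quadraticChar_le {p : ℕ} [Fact p.Prime] (hp : p ≠ 2) (f : (ZMod p)[X])
    {α : ZMod p} (hα : Odd (f.rootMultiplicity α)) :
    |((∑ x : ZMod p, quadraticChar (ZMod p) (f.eval x) : ℤ) : ℝ)| ≤
      (9 * f.natDegree + 12) * √p := by
  have hm0 : (0 : ℝ) ≤ f.natDegree := Nat.cast_nonneg _
  have hp0 : (0 : ℝ) ≤ p := Nat.cast_nonneg _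
  have hf : f ≠ 0 := by rintro rfl; simp at hα
  by_cases hpm : 16 * (f.natDegree + 2) ^ 2 ≤ p
  · obtain ⟨c, hc⟩ : ∃ c : ZMod p, f.eval c ≠ 0 := by
      by_contra! hcon
      have h1 : (Finset.univ : Finset (ZMod p)).card ≤ f.natDegree := by
        apply card_le_degree_of_subset_roots
        intro x _
        rw [mem_roots hf]
        exact hcon x
      rw [Finset.card_univ, ZMod.card] at h1
      nlinarith
    have h1 := abs_sum_quadraticChar_le_of_eval_zero hp (f.comp (X + C c)) (by simpa using hc)
      (α := α - c) (by
        rw [rootMultiplicity_eq_rootMultiplicity, comp_assoc]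
        have : (X + C c).comp (X + C (α - c)) = X + C α := by
          simp [add_assoc]
        rw [this, ← rootMultiplicity_eq_rootMultiplicity]
        exact hα)
      (by rw [natDegree_comp, natDegree_X_add_C, mul_one]; exact hpm)
    rw [natDegree_comp, natDegree_X_add_C, mul_one] at h1
    rw [← Equiv.sum_comp (Equiv.addRight c)]
    simpa using h1
  · push Not at hpm
    have h1 : |((∑ x : ZMod p, quadraticChar (ZMod p) (f.eval x) : ℤ) : ℝ)| ≤ p := by
      have : |∑ x : ZMod p, quadraticChar (ZMod p) (f.eval x)| ≤ (p : ℤ) := by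
        refine (Finset.abs_sum_le_sum_abs _ _).trans ?_
        calc ∑ x : ZMod p, |quadraticChar (ZMod p) (f.eval x)| ≤ ∑ x : ZMod p, (1 : ℤ) := by
              refine Finset.sum_le_sum fun x _ => ?_
              by_cases h0 : f.eval x = 0
              · simp [h0]
              · rcases quadraticChar_dichotomy h0 with h | h <;> simp [h]
          _ = p := by simp
      exact_mod_cast this
    refine h1.trans ?_
    have h2 : √(p : ℝ) ≤ 4 * (f.natDegree + 2) := by
      rw [Real.sqrt_le_left (by positivity)]
      have : (p : ℝ) ≤ 16 * (f.natDegree + 2) ^ 2 := by exact_mod_cast hpm.le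
      nlinarith
    have h3 : (p : ℝ) = √p * √p := (Real.mul_self_sqrt hp0).symm
    nlinarith [Real.sqrt_nonneg (p : ℝ)]

end Weil

section Moments

open Polynomial Finset

lemma rootMultiplicity_prod_X_add_C {F : Type*} [Field F] [DecidableEq F] {n : ℕ} (h : Fin n → F)
    (c : F) : (∏ i, (X + C (h i))).rootMultiplicity (-c) = #{i | h i = c} := by
  have h1 : ∏ i, (X + C (h i)) = ((univ.val.map fun i => -h i).map fun a => X - C a).prod := by
    simp [Finset.prod, Function.comp_def]
  rw [← count_roots, h1, roots_multiset_prod_X_sub_C, Multiset.count_map, Finset.card_def,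
    Finset.filter_val]
  congr 1
  refine Multiset.filter_congr fun i _ => ?_
  rw [neg_inj, eq_comm]

lemma card_image_le_of_even_fibers {γ : Type*} [DecidableEq γ] {r : ℕ} (h : Fin (2 * r) → γ)
    (heven : ∀ c, ¬ Odd #{i | h i = c}) : #(univ.image h) ≤ r := by
  have h1 : #(univ.image h) * 2 ≤ #(univ : Finset (Fin (2 * r))) := by
    rw [mul_comm]
    refine Finset.mul_card_image_le_card univ 2 fun c hc => ?_
    obtain ⟨i, -, hi⟩ := Finset.mem_image.1 hc
    have hpos : 0 < #{i | h i = c} := Finset.card_pos.2 ⟨i, by simp [hi]⟩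
    have := heven c
    rw [Nat.not_odd_iff_even] at this
    obtain ⟨k, hk⟩ := this
    omega
  simp at h1
  omega

lemma card_filter_card_image_le {γ : Type*} [DecidableEq γ] (I : Finset γ) {n r : ℕ} [NeZero n] :
    #{h ∈ Fintype.piFinset (fun _ : Fin n => I) | #(univ.image h) ≤ r} ≤ #I ^ r * r ^ n := by
  have hcard : #((Fintype.piFinset fun _ : Fin r => I) ×ˢ (univ : Finset (Fin n → Fin r))) =
      #I ^ r * r ^ n := by
    rw [card_product, Fintype.card_piFinset_const, card_univ, Fintype.card_fun]
    simp
  rw [← hcard]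
  refine Finset.card_le_card_of_surjOn (fun x => x.1 ∘ x.2) ?_
  intro h hh
  simp only [coe_filter, Fintype.mem_piFinset, Set.mem_ofPred_eq] at hh
  obtain ⟨hI, hr⟩ := hh
  obtain ⟨e⟩ := Function.Embedding.nonempty_of_card_le (α := univ.image h) (β := Fin r)
    (by simpa using hr)
  refine ⟨(Function.extend e Subtype.val fun _ => h 0,
    fun i => e ⟨h i, mem_image_of_mem h (mem_univ i)⟩), ?_, ?_⟩
  · simp only [coe_product, coe_univ, Set.mem_prod, mem_coe, Fintype.mem_piFinset, Set.mem_univ,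
      and_true]
    intro j
    by_cases hj : ∃ x, e x = j
    · obtain ⟨x, rfl⟩ := hj
      rw [e.injective.extend_apply]
      obtain ⟨i, -, hi⟩ := Finset.mem_image.1 x.2
      rw [← hi]
      exact hI i
    · rw [Function.extend_apply' _ _ _ hj]
      exact hI 0
  · funext i
    simp [e.injective.extend_apply]

/-- Moment bound for sums of the quadratic character over translates of a set. -/
lemma sum_pow_sum_quadraticChar_le {p : ℕ} [Fact p.Prime] (hp : p ≠ 2) (I : Finset (ZMod p))
    {r : ℕ} (hr : 0 < r) :
    ∑ y : ZMod p, ((∑ b ∈ I, quadraticChar (ZMod p) (y + b) : ℤ) : ℝ) ^ (2 * r) ≤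
      (#I : ℝ) ^ r * r ^ (2 * r) * p + (#I : ℝ) ^ (2 * r) * ((18 * r + 12) * √p) := by
  classical
  have : NeZero (2 * r) := ⟨by omega⟩
  set χ := quadraticChar (ZMod p)
  set W : (Fin (2 * r) → ZMod p) → ℝ := fun h => ((∑ y : ZMod p, ∏ i, χ (y + h i) : ℤ) : ℝ)
  have hW1 : ∀ h, W h ≤ p := by
    intro h
    have : ∑ y : ZMod p, ∏ i, χ (y + h i) ≤ ∑ y : ZMod p, 1 := by
      refine Finset.sum_le_sum fun y _ => ?_
      rw [← map_prod]
      by_cases h0 : ∏ i, (y + h i) = 0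
      · simp [h0, χ]
      · rcases quadraticChar_dichotomy h0 with h | h <;> simp [χ, h]
    simp only [sum_const, card_univ, ZMod.card, nsmul_eq_mul, mul_one] at this
    simp only [W]
    exact_mod_cast this
  have hW2 : ∀ h, (∃ c, Odd #{i | h i = c}) → W h ≤ (18 * r + 12) * √p := by
    rintro h ⟨c, hc⟩
    rw [← rootMultiplicity_prod_X_add_C h c] at hc
    have := abs_sum_quadraticChar_le hp _ hc
    have hdeg : (∏ i, (X + C (h i))).natDegree = 2 * r := by
      rw [natDegree_prod_of_monic _ _ fun i _ => monic_X_add_C _]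
      simp
    rw [hdeg] at this
    have h2 := (le_abs_self _).trans this
    simp only [eval_prod, eval_add, eval_X, eval_C, map_prod] at h2
    refine h2.trans (le_of_eq ?_)
    push_cast
    ring
  have hexp : ∑ y : ZMod p, ((∑ b ∈ I, χ (y + b) : ℤ) : ℝ) ^ (2 * r) =
      ∑ h ∈ Fintype.piFinset fun _ : Fin (2 * r) => I, W h := by
    simp only [W]
    norm_cast
    rw [Finset.sum_comm]
    exact Finset.sum_congr rfl fun y _ => Finset.sum_pow' _ _ _
  rw [hexp, ← Finset.sum_filter_add_sum_filter_not _ fun h => #(univ.image h) ≤ r]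
  have hc0 : 0 ≤ (18 * r + 12) * √(p : ℝ) := by positivity
  refine add_le_add ?_ ?_
  · refine (Finset.sum_le_card_nsmul _ _ _ fun h _ => hW1 h).trans ?_
    rw [nsmul_eq_mul]
    refine mul_le_mul_of_nonneg_right ?_ (Nat.cast_nonneg _)
    exact_mod_cast card_filter_card_image_le I (n := 2 * r) (r := r)
  · refine (Finset.sum_le_card_nsmul _ _ ((18 * r + 12) * √(p : ℝ)) fun h hh => hW2 h ?_).trans ?_
    · by_contra! hcon
      refine (Finset.mem_filter.1 hh).2 (card_image_le_of_even_fibers h fun c => ?_)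
      exact hcon c
    · rw [nsmul_eq_mul]
      refine mul_le_mul_of_nonneg_right ?_ hc0
      have : #{h ∈ Fintype.piFinset (fun _ : Fin (2 * r) => I) | ¬ #(univ.image h) ≤ r} ≤
          #I ^ (2 * r) := by
        refine (Finset.card_filter_le _ _).trans ?_
        rw [Fintype.card_piFinset_const]
      exact_mod_cast this

end Moments

section ShortSums

open Finset

lemma abs_sum_range_shift_sub_le {f : ℕ → ℤ} (hf : ∀ n, |f n| ≤ 1) (x s : ℕ) :
    |∑ n ∈ range x, f n - ∑ n ∈ range x, f (n + s)| ≤ 2 * s := by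
  have h1 : ∑ n ∈ range (x + s), f n = ∑ n ∈ range x, f n + ∑ n ∈ range s, f (x + n) :=
    sum_range_add _ _ _
  have h2 : ∑ n ∈ range (s + x), f n = ∑ n ∈ range s, f n + ∑ n ∈ range x, f (s + n) :=
    sum_range_add _ _ _
  have h3 : ∀ g : ℕ → ℤ, (∀ n, |g n| ≤ 1) → |∑ n ∈ range s, g n| ≤ s := by
    intro g hg
    refine (abs_sum_le_sum_abs _ _).trans ?_
    calc ∑ n ∈ range s, |g n| ≤ ∑ n ∈ range s, (1 : ℤ) := sum_le_sum fun n _ => hg n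
      _ = s := by simp
  have h4 := h3 f hf
  have h5 := h3 (fun n => f (x + n)) fun n => hf _
  simp only [add_comm s] at h2
  rw [abs_le] at *
  constructor <;> linarith

lemma pow_mul_sum_mul_le {ι : Type*} (s : Finset ι) (ν t : ι → ℝ) (hν : ∀ i, 0 ≤ ν i)
    (ht : ∀ i, 0 ≤ t i) {K : ℝ} (hK : 0 ≤ K) (r : ℕ) :
    K ^ r * ∑ i ∈ s, ν i * t i ≤ K ^ (r + 1) * ∑ i ∈ s, ν i +
      √(∑ i ∈ s, ν i ^ 2) * √(∑ i ∈ s, t i ^ (2 * (r + 1))) := by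
  have h1 : ∀ i, K ^ r * (ν i * t i) ≤ K ^ (r + 1) * ν i + ν i * t i ^ (r + 1) := by
    intro i
    have : K ^ r * t i ≤ K ^ (r + 1) + t i ^ (r + 1) := by
      rcases le_total (t i) K with h | h
      · have : K ^ r * t i ≤ K ^ r * K := mul_le_mul_of_nonneg_left h (pow_nonneg hK r)
        have := pow_nonneg (ht i) (r + 1)
        rw [pow_succ K]
        linarith
      · have : K ^ r * t i ≤ t i ^ r * t i :=
          mul_le_mul_of_nonneg_right (pow_le_pow_left₀ hK h r) (ht i)
        have := pow_nonneg hK (r + 1)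
        rw [pow_succ (t i)]
        linarith
    calc K ^ r * (ν i * t i) = ν i * (K ^ r * t i) := by ring
      _ ≤ ν i * (K ^ (r + 1) + t i ^ (r + 1)) := mul_le_mul_of_nonneg_left this (hν i)
      _ = _ := by ring
  have h2 : ∑ i ∈ s, ν i * t i ^ (r + 1) ≤
      √(∑ i ∈ s, ν i ^ 2) * √(∑ i ∈ s, t i ^ (2 * (r + 1))) := by
    refine (Real.sum_mul_le_sqrt_mul_sqrt s ν fun i => t i ^ (r + 1)).trans (le_of_eq ?_)
    simp only [← pow_mul, mul_comm]
  rw [mul_sum, mul_sum]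
  calc _ ≤ ∑ i ∈ s, (K ^ (r + 1) * ν i + ν i * t i ^ (r + 1)) := sum_le_sum fun i _ => h1 i
    _ ≤ _ := by rw [sum_add_distrib]; linarith

lemma card_filter_dvd_range_le (x a : ℕ) : #{n ∈ range x | a ∣ n} ≤ x / a + 1 := by
  rcases Nat.eq_zero_or_pos a with rfl | ha
  · have : {n ∈ range x | 0 ∣ n} ⊆ {0} := by
      intro n hn
      simpa using (mem_filter.1 hn).2
    simpa using card_le_card this
  · have : {n ∈ range x | a ∣ n} ⊆ (range (x / a + 1)).image (a * ·) := by
      intro n hn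
      obtain ⟨h1, k, rfl⟩ := mem_filter.1 hn
      refine mem_image.2 ⟨k, ?_, rfl⟩
      rw [mem_range] at *
      rw [Nat.lt_succ_iff, Nat.le_div_iff_mul_le ha]
      linarith
    exact (card_le_card this).trans (card_image_le.trans (by simp))

lemma card_mul_eq_mul_le {a b : ℕ} (ha : a.Prime) (hb : b.Prime) (x : ℕ) :
    #{n ∈ range x ×ˢ range x | n.1 * b = n.2 * a} ≤ if a = b then x else x / a + 1 := by
  have hinj : ∀ s : Finset ℕ, (∀ n ∈ {n ∈ range x ×ˢ range x | n.1 * b = n.2 * a}, n.1 ∈ s) →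
      #{n ∈ range x ×ˢ range x | n.1 * b = n.2 * a} ≤ #s := by
    intro s hs
    refine card_le_card_of_injOn Prod.fst hs ?_
    rintro ⟨n, m⟩ h1 ⟨n', m'⟩ h2 (rfl : n = n')
    have h3 := (mem_filter.1 h1).2
    have h4 := (mem_filter.1 h2).2
    dsimp only at h3 h4
    rw [h3] at h4
    rw [Nat.eq_of_mul_eq_mul_right ha.pos h4]
  split_ifs with hab
  · refine (hinj (range x) fun n hn => (mem_product.1 (mem_filter.1 hn).1).1).trans (by simp)
  · refine (hinj {n ∈ range x | a ∣ n} fun n hn => ?_).trans (card_filter_dvd_range_le x a)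
    obtain ⟨h1, h2⟩ := mem_filter.1 hn
    refine mem_filter.2 ⟨(mem_product.1 h1).1, ?_⟩
    have : a ∣ n.1 * b := h2 ▸ dvd_mul_left _ _
    refine (ha.coprime_iff_not_dvd.2 fun h => hab ?_).dvd_of_dvd_mul_right this
    exact (Nat.prime_dvd_prime_iff_eq ha hb).1 h

/-- The number of pairs `(a, n)` with `a` prime, `a ≤ A`, `n < x` and `n ≡ a y` modulo `p`. -/
def fractionCount (p A x : ℕ) [Fact p.Prime] (y : ZMod p) : ℕ :=
  #{u ∈ Nat.primesLE A ×ˢ range x | (u.2 : ZMod p) * (u.1 : ZMod p)⁻¹ = y}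

lemma sum_fractionCount_mul {p : ℕ} [Fact p.Prime] (A x : ℕ) (t : ZMod p → ℝ) :
    ∑ y, (fractionCount p A x y : ℝ) * t y =
      ∑ a ∈ Nat.primesLE A, ∑ n ∈ range x, t ((n : ZMod p) * (a : ZMod p)⁻¹) := by
  rw [← sum_product', ← sum_fiberwise_of_maps_to (s := Nat.primesLE A ×ˢ range x) (t := univ)
    (g := fun u : ℕ × ℕ => (u.2 : ZMod p) * (u.1 : ZMod p)⁻¹) fun _ _ => mem_univ _]
  refine sum_congr rfl fun y _ => ?_
  rw [sum_congr rfl (g := fun _ => t y) fun u hu => by rw [(mem_filter.1 hu).2]]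
  simp [fractionCount]

lemma natCast_ne_zero_of_lt {p a : ℕ} (ha : 0 < a) (hap : a < p) : (a : ZMod p) ≠ 0 := by
  rw [Ne, ZMod.natCast_eq_zero_iff]
  exact fun h => absurd (Nat.le_of_dvd ha h) (by omega)

lemma sum_sq_fractionCount_le {p : ℕ} [Fact p.Prime] {A x : ℕ} (hAp : A < p) (hAx : A * x < p)
    (hx : A ≤ x) :
    ∑ y, (fractionCount p A x y : ℝ) ^ 2 ≤ #(Nat.primesLE A) * x * (3 + Real.log A) := by
  have h1 : ∀ a ∈ Nat.primesLE A, ∀ b ∈ Nat.primesLE A,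
      #{n ∈ range x ×ˢ range x |
        (n.1 : ZMod p) * (a : ZMod p)⁻¹ = (n.2 : ZMod p) * (b : ZMod p)⁻¹} ≤
      if a = b then x else x / a + 1 := by
    intro a ha b hb
    rw [Nat.mem_primesLE] at ha hb
    refine le_trans (card_le_card ?_) (card_mul_eq_mul_le ha.2 hb.2 x)
    intro n hn
    obtain ⟨hn1, hn2⟩ := mem_filter.1 hn
    refine mem_filter.2 ⟨hn1, ?_⟩
    rw [mem_product, mem_range, mem_range] at hn1
    have ha0 := natCast_ne_zero_of_lt ha.2.pos (ha.1.trans_lt hAp)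
    have hb0 := natCast_ne_zero_of_lt hb.2.pos (hb.1.trans_lt hAp)
    field_simp at hn2
    have h3 : ((n.1 * b : ℕ) : ZMod p) = ((n.2 * a : ℕ) : ZMod p) := by
      push_cast
      linear_combination hn2
    rw [ZMod.natCast_eq_natCast_iff] at h3
    refine Nat.ModEq.eq_of_lt_of_lt h3 ?_ ?_
    · calc n.1 * b ≤ x * A := Nat.mul_le_mul hn1.1.le hb.1
        _ < p := by rwa [mul_comm]
    · calc n.2 * a ≤ x * A := Nat.mul_le_mul hn1.2.le ha.1
        _ < p := by rwa [mul_comm]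
  have h2 : ∑ y, (fractionCount p A x y : ℝ) ^ 2 = ∑ a ∈ Nat.primesLE A, ∑ b ∈ Nat.primesLE A,
      (#{n ∈ range x ×ˢ range x |
        (n.1 : ZMod p) * (a : ZMod p)⁻¹ = (n.2 : ZMod p) * (b : ZMod p)⁻¹} : ℝ) := by
    simp only [pow_two]
    rw [sum_fractionCount_mul]
    refine sum_congr rfl fun a _ => ?_
    have h3 : ∀ n ∈ range x, (fractionCount p A x ((n : ZMod p) * (a : ZMod p)⁻¹) : ℝ) =
        ∑ b ∈ Nat.primesLE A, ∑ m ∈ range x,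
          if (n : ZMod p) * (a : ZMod p)⁻¹ = (m : ZMod p) * (b : ZMod p)⁻¹ then (1 : ℝ) else 0 := by
      intro n _
      rw [← sum_product', fractionCount, card_filter]
      push_cast
      exact sum_congr rfl fun u _ => by simp only [eq_comm]
    rw [sum_congr rfl h3, sum_comm]
    refine sum_congr rfl fun b _ => ?_
    rw [← sum_product', card_filter]
    push_cast
    rfl
  rw [h2]
  have h4 : ∀ a ∈ Nat.primesLE A, ∀ b ∈ Nat.primesLE A,
      (#{n ∈ range x ×ˢ range x |
        (n.1 : ZMod p) * (a : ZMod p)⁻¹ = (n.2 : ZMod p) * (b : ZMod p)⁻¹} : ℝ) ≤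
      (if a = b then (x : ℝ) else 0) + (x * (a : ℝ)⁻¹ + 1) := by
    intro a ha b hb
    refine (Nat.cast_le.2 (h1 a ha b hb)).trans ?_
    split_ifs with hab
    · have : (0 : ℝ) ≤ x * (a : ℝ)⁻¹ + 1 := by positivity
      linarith
    · push_cast
      rw [← div_eq_mul_inv]
      have := Nat.cast_div_le (α := ℝ) (m := x) (n := a)
      linarith
  refine (sum_le_sum fun a ha => sum_le_sum fun b hb => h4 a ha b hb).trans ?_
  have h5 : ∑ a ∈ Nat.primesLE A, (a : ℝ)⁻¹ ≤ 1 + Real.log A := by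
    refine le_trans ?_ (harmonic_le_one_add_log A)
    rw [harmonic_eq_sum_Icc]
    push_cast
    refine sum_le_sum_of_subset_of_nonneg ?_ fun _ _ _ => by positivity
    intro a ha
    rw [Nat.mem_primesLE] at ha
    exact mem_Icc.2 ⟨ha.2.pos, ha.1⟩
  have h6 : (#(Nat.primesLE A) : ℝ) ≤ x := by
    have : #(Nat.primesLE A) ≤ A := by
      have : Nat.primesLE A ⊆ Icc 1 A := by
        intro a ha
        rw [Nat.mem_primesLE] at ha
        exact mem_Icc.2 ⟨ha.2.pos, ha.1⟩
      simpa using card_le_card this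
    exact_mod_cast this.trans hx
  simp only [sum_add_distrib, sum_const, nsmul_eq_mul, mul_one]
  have h7 : ∑ a ∈ Nat.primesLE A, ∑ b ∈ Nat.primesLE A, (if a = b then (x : ℝ) else 0) =
      #(Nat.primesLE A) * x := by
    rw [sum_congr rfl (g := fun _ => (x : ℝ)) fun a ha => by simp [ha]]
    simp
  rw [h7, ← mul_sum, ← mul_sum]
  have hP : (0 : ℝ) ≤ #(Nat.primesLE A) := Nat.cast_nonneg _
  have hx0 : (0 : ℝ) ≤ x := Nat.cast_nonneg _
  have h8 : (x : ℝ) * ∑ a ∈ Nat.primesLE A, (a : ℝ)⁻¹ ≤ x * (1 + Real.log A) :=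
    mul_le_mul_of_nonneg_left h5 hx0
  have h9 := mul_le_mul_of_nonneg_left (add_le_add h8 h6) hP
  linarith

end ShortSums

section ShortSums

open Finset

lemma abs_quadraticChar_le_one {F : Type*} [Field F] [Fintype F] [DecidableEq F] (a : F) :
    |quadraticChar F a| ≤ 1 := by
  by_cases h0 : a = 0
  · simp [h0]
  · rcases quadraticChar_dichotomy h0 with h | h <;> simp [h]

lemma sum_range_quadraticChar_add_mul {p : ℕ} [Fact p.Prime] {a : ℕ} (ha : (a : ZMod p) ≠ 0)
    (x b : ℕ) :
    ∑ n ∈ range x, quadraticChar (ZMod p) ((n + a * b : ℕ) : ZMod p) =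
      quadraticChar (ZMod p) a *
        ∑ n ∈ range x, quadraticChar (ZMod p) ((n : ZMod p) * (a : ZMod p)⁻¹ + b) := by
  rw [mul_sum]
  refine sum_congr rfl fun n _ => ?_
  rw [← map_mul]
  congr 1
  push_cast
  field_simp

lemma abs_sum_range_mul_le {p : ℕ} [Fact p.Prime] {A : ℕ} (hAp : A < p) (x B : ℕ) :
    |((∑ n ∈ range x, quadraticChar (ZMod p) (n : ZMod p) : ℤ) : ℝ)| *
        (#(Nat.primesLE A) * B) ≤
      2 * (A * B) * (#(Nat.primesLE A) * B) +
      ∑ y, (fractionCount p A x y : ℝ) *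
        |((∑ b ∈ Icc 1 B, quadraticChar (ZMod p) (y + (b : ℕ)) : ℤ) : ℝ)| := by
  set χ := quadraticChar (ZMod p)
  set S : ℤ := ∑ n ∈ range x, χ (n : ZMod p)
  have h1 : ∀ a ∈ Nat.primesLE A, |S| * B ≤ 2 * (A * B) * B +
      ∑ n ∈ range x, |∑ b ∈ Icc 1 B, χ ((n : ZMod p) * (a : ZMod p)⁻¹ + (b : ℕ))| := by
    intro a ha
    rw [Nat.mem_primesLE] at ha
    have ha0 := natCast_ne_zero_of_lt ha.2.pos (ha.1.trans_lt hAp)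
    have h2 : |∑ b ∈ Icc 1 B, (S - ∑ n ∈ range x, χ ((n + a * b : ℕ) : ZMod p))| ≤
        B * (2 * (A * B)) := by
      refine (abs_sum_le_sum_abs _ _).trans ?_
      refine (sum_le_card_nsmul _ _ (2 * (A * B) : ℤ) fun b hb => ?_).trans (by simp)
      refine (abs_sum_range_shift_sub_le (f := fun n => χ (n : ZMod p))
        (fun n => abs_quadraticChar_le_one _) x (a * b)).trans ?_
      have : a * b ≤ A * B := Nat.mul_le_mul ha.1 (mem_Icc.1 hb).2
      exact_mod_cast Nat.mul_le_mul_left 2 this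
    have h3 : ∑ b ∈ Icc 1 B, (S - ∑ n ∈ range x, χ ((n + a * b : ℕ) : ZMod p)) = S * B -
        χ a * ∑ n ∈ range x, ∑ b ∈ Icc 1 B, χ ((n : ZMod p) * (a : ZMod p)⁻¹ + (b : ℕ)) := by
      rw [sum_sub_distrib, sum_congr rfl fun b _ => sum_range_quadraticChar_add_mul ha0 x b,
        ← mul_sum, sum_comm (s := range x)]
      simp [mul_comm, χ]
    rw [h3] at h2
    have h4 : |S * B| ≤ B * (2 * (A * B)) + |χ a *
        ∑ n ∈ range x, ∑ b ∈ Icc 1 B, χ ((n : ZMod p) * (a : ZMod p)⁻¹ + (b : ℕ))| := by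
      have := abs_sub_abs_le_abs_sub (S * B : ℤ) (χ a *
        ∑ n ∈ range x, ∑ b ∈ Icc 1 B, χ ((n : ZMod p) * (a : ZMod p)⁻¹ + (b : ℕ)))
      linarith
    rw [abs_mul, abs_mul, Nat.abs_cast] at h4
    have h5 := abs_sum_le_sum_abs (fun n : ℕ => ∑ b ∈ Icc 1 B,
      χ ((n : ZMod p) * (a : ZMod p)⁻¹ + (b : ℕ))) (range x)
    have h6 := mul_le_mul (abs_quadraticChar_le_one (a : ZMod p)) h5 (abs_nonneg _) zero_le_one
    linarith
  have h7 := sum_le_sum h1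
  rw [sum_fractionCount_mul]
  simp only [sum_add_distrib, sum_const, nsmul_eq_mul] at h7
  have h8 : ((#(Nat.primesLE A) * (|S| * B) : ℤ) : ℝ) ≤ _ := Int.cast_le.2 h7
  push_cast at h8 ⊢
  linarith

lemma abs_sum_range_quadraticChar_le {p : ℕ} [Fact p.Prime] (hp : p ≠ 2) {x A B r : ℕ} {κ : ℝ}
    (hκ : 0 < κ) (hB : 0 < B) (hBp : B < p) (hAp : A < p) (hAx : A * x < p) (hx : A ≤ x)
    (hA : 2 ≤ A) (hBr : √p ≤ (B : ℝ) ^ (r + 1))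
    (hlarge : (3 + Real.log A) * (((r + 1 : ℕ) : ℝ) ^ (2 * (r + 1)) + (18 * (r + 1 : ℕ) + 12)) * √p
      ≤ κ ^ (2 * (r + 1)) * (#(Nat.primesLE A) * x)) :
    |((∑ n ∈ range x, quadraticChar (ZMod p) (n : ZMod p) : ℤ) : ℝ)| ≤
      2 * (A * B) + 2 * κ * x := by
  classical
  set χ := quadraticChar (ZMod p)
  set t : ZMod p → ℝ := fun y => |((∑ b ∈ Icc 1 B, χ (y + (b : ℕ)) : ℤ) : ℝ)| with ht
  set P : ℝ := (#(Nat.primesLE A) : ℝ) with hP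
  set c : ℝ := ((r + 1 : ℕ) : ℝ) ^ (2 * (r + 1)) + (18 * (r + 1 : ℕ) + 12) with hc
  have hP0 : 0 < P := by
    rw [hP, Nat.cast_pos, card_pos]
    exact ⟨2, Nat.mem_primesLE.2 ⟨hA, Nat.prime_two⟩⟩
  have hB0 : (0 : ℝ) < B := Nat.cast_pos.2 hB
  have hinj : Set.InjOn (fun b : ℕ => (b : ZMod p)) (Icc 1 B : Finset ℕ) := by
    intro b hb b' hb' h
    have hb := (mem_Icc.1 hb).2
    have hb' := (mem_Icc.1 hb').2
    exact Nat.ModEq.eq_of_lt_of_lt ((ZMod.natCast_eq_natCast_iff _ _ _).1 h)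
      (hb.trans_lt hBp) (hb'.trans_lt hBp)
  have hmom : ∑ y, t y ^ (2 * (r + 1)) ≤ ((B : ℝ) ^ (r + 1)) ^ 2 * (c * √p) := by
    have h1 := sum_pow_sum_quadraticChar_le hp ((Icc 1 B).image fun b : ℕ => (b : ZMod p))
      r.succ_pos
    rw [card_image_of_injOn hinj, Nat.card_Icc, Nat.add_sub_cancel] at h1
    have h2 : ∀ y, t y ^ (2 * (r + 1)) =
        ((∑ b ∈ (Icc 1 B).image fun b : ℕ => (b : ZMod p), χ (y + b) : ℤ) : ℝ) ^ (2 * (r + 1)) := by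
      intro y
      rw [sum_image hinj, ht]
      exact (even_two_mul _).pow_abs _
    rw [sum_congr rfl fun y _ => h2 y]
    refine h1.trans ?_
    have h3 : (p : ℝ) ≤ (B : ℝ) ^ (r + 1) * √p := by
      calc (p : ℝ) = √p * √p := (Real.mul_self_sqrt (Nat.cast_nonneg p)).symm
        _ ≤ _ := mul_le_mul_of_nonneg_right hBr (Real.sqrt_nonneg _)
    have h4 := mul_le_mul_of_nonneg_left h3
      (by positivity : 0 ≤ (B : ℝ) ^ (r + 1) * ((r + 1 : ℕ) : ℝ) ^ (2 * (r + 1)))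
    have h5 : (B : ℝ) ^ (2 * (r + 1)) = (B : ℝ) ^ (r + 1) * (B : ℝ) ^ (r + 1) := by
      rw [← pow_add]; ring_nf
    rw [Nat.succ_eq_add_one, h5, hc]
    linarith
  have hν2 := sum_sq_fractionCount_le hAp hAx hx
  rw [← hP] at hν2
  have hν1 : ∑ y, (fractionCount p A x y : ℝ) = P * x := by
    have := sum_fractionCount_mul (p := p) A x fun _ => 1
    simpa [hP] using this
  set K := κ * B with hK
  have hK0 : 0 < K := mul_pos hκ hB0
  have key := pow_mul_sum_mul_le univ (fun y => (fractionCount p A x y : ℝ)) t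
    (fun y => Nat.cast_nonneg _) (fun y => abs_nonneg _) hK0.le r
  have hsqrt : √(∑ y, (fractionCount p A x y : ℝ) ^ 2) * √(∑ y, t y ^ (2 * (r + 1))) ≤
      K ^ (r + 1) * (P * x) := by
    rw [← Real.sqrt_mul (sum_nonneg fun y _ => sq_nonneg _), Real.sqrt_le_left (by positivity)]
    calc _ ≤ (P * x * (3 + Real.log A)) * (((B : ℝ) ^ (r + 1)) ^ 2 * (c * √p)) :=
          mul_le_mul hν2 hmom (sum_nonneg fun y _ => pow_nonneg (abs_nonneg _) _)
            ((sum_nonneg fun y _ => sq_nonneg _).trans hν2)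
      _ = (P * x * ((B : ℝ) ^ (r + 1)) ^ 2) * ((3 + Real.log A) * c * √p) := by ring
      _ ≤ (P * x * ((B : ℝ) ^ (r + 1)) ^ 2) * (κ ^ (2 * (r + 1)) * (P * x)) :=
          mul_le_mul_of_nonneg_left hlarge (by positivity)
      _ = (K ^ (r + 1) * (P * x)) ^ 2 := by rw [hK, mul_pow]; ring
  have h1 : K ^ r * ∑ y, (fractionCount p A x y : ℝ) * t y ≤ K ^ r * (2 * K * (P * x)) := by
    rw [hν1] at key
    calc _ ≤ K ^ (r + 1) * (P * x) + K ^ (r + 1) * (P * x) := by linarith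
      _ = _ := by ring
  have h2 := le_of_mul_le_mul_left h1 (pow_pos hK0 r)
  have h3 := abs_sum_range_mul_le hAp x B
  rw [← hP] at h3
  refine le_of_mul_le_mul_right (h3.trans ?_) (mul_pos hP0 hB0)
  calc _ ≤ 2 * (A * B) * (P * B) + 2 * K * (P * x) := by linarith
    _ = _ := by rw [hK]; ring

end ShortSums

section Burgess

open Filter Finset

lemma eventually_div_log_le_primeCounting :
    ∀ᶠ n : ℕ in atTop, (n : ℝ) / (4 * Real.log n) ≤ Nat.primeCounting n := by
  have h1 := (Real.isLittleO_log_id_atTop.bound (c := 1 / 8) (by norm_num))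
  have h2 := (tendsto_natCast_atTop_atTop (R := ℝ)).comp (tendsto_add_atTop_nat 1)
  filter_upwards [h2.eventually h1, eventually_ge_atTop 2] with n hn hn2
  refine le_trans ?_ (Chebyshev.pi_ge n)
  have hn2' : (2 : ℝ) ≤ n := by exact_mod_cast hn2
  have hlog : 0 < Real.log n := Real.log_pos (by linarith)
  simp only [Function.comp_apply, id, Real.norm_eq_abs, Nat.cast_add, Nat.cast_one] at hn
  rw [abs_of_pos (by positivity : (0 : ℝ) < n + 1)] at hn
  have h3 := (le_abs_self _).trans hn
  have h4 : (0.69 : ℝ) * n ≤ n * Real.log 2 := by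
    rw [mul_comm]
    exact mul_le_mul_of_nonneg_left (by linarith [Real.log_two_gt_d9]) (by linarith)
  rw [← div_div, div_le_div_iff_of_pos_right hlog]
  linarith

lemma abs_sum_range_quadraticChar_le_of_params {p r : ℕ} [Fact p.Prime] {κ u w c : ℝ}
    (hκ : 0 < κ) (hp3 : 3 ≤ p)
    (hc : c = ((r + 1 : ℕ) : ℝ) ^ (2 * (r + 1)) + (18 * (r + 1 : ℕ) + 12)) (hw4 : w ^ 4 = p)
    (hu2 : 2 ≤ u) (hw2 : 2 ≤ w) (hu5w : u ^ 5 ≤ w) (hlog : Real.log p ≤ u)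
    (hur : w ^ 2 ≤ (u ^ 2) ^ (r + 1)) (hu1 : 16 ≤ u * κ)
    (hu3 : 64 * c ≤ u * (κ / 4) ^ (2 * (r + 1)))
    (hpi : (⌊w * u⌋₊ : ℝ) / (4 * Real.log ⌊w * u⌋₊) ≤ Nat.primeCounting ⌊w * u⌋₊) :
    |((∑ n ∈ range ⌊w * u ^ 4⌋₊, quadraticChar (ZMod p) (n : ZMod p) : ℤ) : ℝ)| ≤
      κ * ⌊w * u ^ 4⌋₊ := by
  have hw0 : 0 < w := by linarith
  have hu0 : 0 < u := by linarith
  have hc0 : 0 < c := by rw [hc]; positivity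
  have hsq : √(p : ℝ) = w ^ 2 := by
    rw [← hw4, show w ^ 4 = (w ^ 2) ^ 2 by ring]
    exact Real.sqrt_sq (by positivity)
  have hu14 : u ≤ u ^ 4 := le_self_pow₀ (by linarith) (by norm_num)
  have hu15 : u ≤ u ^ 5 := le_self_pow₀ (by linarith) (by norm_num)
  have hu24 : u ^ 2 ≤ u ^ 4 := pow_le_pow_right₀ (by linarith) (by norm_num)
  have huw : u ≤ w := hu15.trans hu5w
  have hu2_4 : 2 ^ 2 ≤ u ^ 2 := pow_le_pow_left₀ (by norm_num) hu2 2
  have hw2_4 : 2 ^ 2 ≤ w ^ 2 := pow_le_pow_left₀ (by norm_num) hw2 2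
  have hwu : 4 ≤ w * u := by
    calc (4 : ℝ) = 2 * 2 := by norm_num
      _ ≤ w * u := by gcongr
  have hwu4 : 4 ≤ w * u ^ 4 := hwu.trans (by gcongr)
  have h24 : 2 * w ^ 2 < w ^ 4 := by
    calc 2 * w ^ 2 < 4 * w ^ 2 := by linarith
      _ ≤ w ^ 2 * w ^ 2 := by gcongr; linarith
      _ = w ^ 4 := by ring
  obtain ⟨x, hx⟩ : ∃ x, x = ⌊w * u ^ 4⌋₊ := ⟨_, rfl⟩
  obtain ⟨A, hA⟩ : ∃ A, A = ⌊w * u⌋₊ := ⟨_, rfl⟩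
  obtain ⟨B, hB⟩ : ∃ B, B = ⌈u ^ 2⌉₊ := ⟨_, rfl⟩
  have hAle : (A : ℝ) ≤ w * u := hA ▸ Nat.floor_le (by positivity)
  have hxle : (x : ℝ) ≤ w * u ^ 4 := hx ▸ Nat.floor_le (by positivity)
  have hAge : w * u / 2 ≤ A := by rw [hA]; linarith [Nat.lt_floor_add_one (w * u)]
  have hxge : w * u ^ 4 / 2 ≤ x := by rw [hx]; linarith [Nat.lt_floor_add_one (w * u ^ 4)]
  have hBge : u ^ 2 ≤ B := hB ▸ Nat.le_ceil _
  have hBlt : (B : ℝ) < u ^ 2 + 1 := hB ▸ Nat.ceil_lt_add_one (by positivity)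
  have hBle : (B : ℝ) ≤ 2 * u ^ 2 := by linarith
  have hA2 : 2 ≤ A := by
    have : (2 : ℝ) ≤ A := by linarith
    exact_mod_cast this
  have hAx : A ≤ x := by
    rw [hA, hx]
    exact Nat.floor_mono (mul_le_mul_of_nonneg_left hu14 hw0.le)
  have hAxp : A * x < p := by
    have h1 : ((A * x : ℕ) : ℝ) < p := by
      push_cast
      calc (A : ℝ) * x ≤ (w * u) * (w * u ^ 4) := by gcongr
        _ = w ^ 2 * u ^ 5 := by ring
        _ ≤ w ^ 2 * w := by gcongr
        _ < w ^ 2 * w ^ 2 := by gcongr; exact lt_self_pow₀ (by linarith) (by norm_num)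
        _ = p := by rw [← hw4]; ring
    exact_mod_cast h1
  have hAp : A < p := lt_of_le_of_lt (Nat.le_mul_of_pos_right _ (by omega)) hAxp
  have hBp : B < p := by
    have h1 : (B : ℝ) < p := by
      calc (B : ℝ) ≤ 2 * u ^ 2 := hBle
        _ ≤ 2 * w ^ 2 := by gcongr
        _ < w ^ 4 := h24
        _ = p := hw4
    exact_mod_cast h1
  have hBr : √(p : ℝ) ≤ (B : ℝ) ^ (r + 1) := by
    rw [hsq]
    exact hur.trans (by gcongr)
  have hp3' : (3 : ℝ) ≤ p := by exact_mod_cast hp3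
  have hL0 : 1 ≤ Real.log p := by
    rw [Real.le_log_iff_exp_le (by linarith)]
    linarith [Real.exp_one_lt_d9]
  have hA0 : (1 : ℝ) < A := by exact_mod_cast hA2
  have hlogA0 : 0 < Real.log A := Real.log_pos hA0
  have hlogA : Real.log A ≤ Real.log p :=
    Real.log_le_log (by linarith) (by exact_mod_cast hAp.le)
  have hP : w / 8 ≤ (#(Nat.primesLE A) : ℝ) := by
    rw [← hA] at hpi
    rw [Nat.primesLE_card_eq_primeCounting]
    calc w / 8 = w * u / 2 / (4 * u) := by field_simp; norm_num
      _ ≤ A / (4 * Real.log A) := by gcongr; exact hlogA.trans hlog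
      _ ≤ _ := hpi
  have hlarge : (3 + Real.log A) * c * √(p : ℝ) ≤
      (κ / 4) ^ (2 * (r + 1)) * (#(Nat.primesLE A) * x) := by
    have h3 : 3 + Real.log A ≤ 4 * u := by linarith
    calc (3 + Real.log A) * c * √(p : ℝ) ≤ (4 * u) * c * w ^ 2 := by
          rw [hsq]; gcongr
      _ = (64 * c) * (u * w ^ 2 / 16) := by ring
      _ ≤ (u * (κ / 4) ^ (2 * (r + 1))) * (u * w ^ 2 / 16) := by gcongr
      _ = (κ / 4) ^ (2 * (r + 1)) * ((w / 8) * (w * u ^ 2 / 2)) := by ring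
      _ ≤ (κ / 4) ^ (2 * (r + 1)) * ((w / 8) * (w * u ^ 4 / 2)) := by gcongr
      _ ≤ _ := by gcongr
  rw [← hx]
  refine (abs_sum_range_quadraticChar_le (by omega) (by positivity : 0 < κ / 4)
    (hB ▸ Nat.ceil_pos.2 (by positivity)) hBp hAp hAxp hAx hA2 hBr (hc ▸ hlarge)).trans ?_
  have h4 : 2 * ((A : ℝ) * B) ≤ κ / 2 * x := by
    calc 2 * ((A : ℝ) * B) ≤ 2 * ((w * u) * (2 * u ^ 2)) := by gcongr
      _ = 16 * (w * u ^ 3 / 4) := by ring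
      _ ≤ (u * κ) * (w * u ^ 3 / 4) := by gcongr
      _ = κ / 2 * (w * u ^ 4 / 2) := by ring
      _ ≤ _ := by gcongr
  linarith

/-- Burgess' theorem for the initial intervals of length `p ^ (1 / 4 + η)`. -/
theorem eventually_abs_sum_range_quadraticChar_le {η κ : ℝ} (hη : 0 < η) (hη1 : η ≤ 1 / 100)
    (hκ : 0 < κ) :
    ∀ᶠ p : ℕ in atTop, ∀ _ : Fact p.Prime,
      |((∑ n ∈ range ⌊(p : ℝ) ^ (1 / 4 + η)⌋₊, quadraticChar (ZMod p) (n : ZMod p) : ℤ) : ℝ)| ≤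
        κ * ⌊(p : ℝ) ^ (1 / 4 + η)⌋₊ := by
  obtain ⟨r, hr⟩ : ∃ r : ℕ, 1 / η ≤ r := exists_nat_ge _
  rw [div_le_iff₀ hη] at hr
  obtain ⟨c, hc⟩ : ∃ c : ℝ, c = ((r + 1 : ℕ) : ℝ) ^ (2 * (r + 1)) + (18 * (r + 1 : ℕ) + 12) :=
    ⟨_, rfl⟩
  have hcast := tendsto_natCast_atTop_atTop (R := ℝ)
  have hu := (tendsto_rpow_atTop (y := η / 4) (by positivity)).comp hcast
  have hw := (tendsto_rpow_atTop (y := 1 / 4) (by norm_num)).comp hcast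
  have hA := tendsto_nat_floor_atTop.comp (hw.atTop_mul_atTop₀ hu)
  have hlog := hcast.eventually ((isLittleO_log_rpow_atTop
    (by positivity : 0 < η / 4)).bound one_pos)
  filter_upwards [hu.eventually_ge_atTop (16 / κ), hu.eventually_ge_atTop 2,
    hu.eventually_ge_atTop (64 * c / (κ / 4) ^ (2 * (r + 1))), hw.eventually_ge_atTop 2,
    hA.eventually eventually_div_log_le_primeCounting, hlog,
    eventually_ge_atTop 3] with p hu1 hu2 hu3 hw2 hpi hlog hp3 hp
  simp only [Function.comp_apply, Real.norm_eq_abs, one_mul] at hu1 hu2 hu3 hw2 hpi hlog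
  have hX3 : (3 : ℝ) ≤ p := by exact_mod_cast hp3
  have hX0 : (0 : ℝ) ≤ p := by linarith
  have hx : (p : ℝ) ^ (1 / 4 + η) = (p : ℝ) ^ (1 / 4 : ℝ) * ((p : ℝ) ^ (η / 4)) ^ 4 := by
    rw [Real.rpow_add (by linarith), ← Real.rpow_mul_natCast hX0 (η / 4)]
    congr 2
    push_cast
    ring
  rw [hx]
  refine abs_sum_range_quadraticChar_le_of_params hκ hp3 hc ?_ hu2 hw2 ?_ ?_ ?_
    ((div_le_iff₀ hκ).1 hu1) ((div_le_iff₀ (by positivity)).1 hu3) hpi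
  · rw [← Real.rpow_mul_natCast hX0]
    norm_num
  · rw [← Real.rpow_mul_natCast hX0]
    refine Real.rpow_le_rpow_of_exponent_le (by linarith) ?_
    push_cast
    linarith
  · exact (le_abs_self _).trans (hlog.trans (le_of_eq (abs_of_nonneg (by linarith))))
  · rw [← pow_mul, ← Real.rpow_mul_natCast hX0, ← Real.rpow_mul_natCast hX0]
    refine Real.rpow_le_rpow_of_exponent_le (by linarith) ?_
    push_cast
    linarith

end Burgess

section Mertens

open Finset

lemma div_sub_one_lt_natCast_div (m n : ℕ) : (m : ℝ) / n - 1 < (m / n : ℕ) := by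
  rw [← Nat.floor_div_eq_div (K := ℝ)]
  exact Nat.sub_one_lt_floor _

lemma log_factorial_eq_sum (n : ℕ) :
    Real.log (n.factorial : ℕ) =
      ∑ q ∈ Nat.primesLE n, (n.factorial.factorization q : ℝ) * Real.log q := by
  rw [Real.log_nat_eq_sum_factorization, Finsupp.sum]
  refine sum_subset (fun q hq => ?_) fun q _ hq => ?_
  · rw [Nat.support_factorization, Nat.mem_primeFactors] at hq
    exact Nat.mem_primesLE.2 ⟨(hq.1.dvd_factorial).1 hq.2.1, hq.1⟩
  · rw [Finsupp.notMem_support_iff.1 hq]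
    simp

lemma exists_sum_log_div_mul_pred_le :
    ∃ C : ℝ, ∀ n, ∑ q ∈ Nat.primesLE n, Real.log q / (q * (q - 1)) ≤ C := by
  have hs : Summable fun q : ℕ => 4 * (1 / (q : ℝ) ^ (3 / 2 : ℝ)) :=
    (Real.summable_one_div_nat_rpow.2 (by norm_num)).mul_left 4
  refine ⟨∑' q : ℕ, 4 * (1 / (q : ℝ) ^ (3 / 2 : ℝ)), fun n => ?_⟩
  refine le_trans (sum_le_sum fun q hq => ?_) (hs.sum_le_tsum _ fun _ _ => by positivity)
  have hq2 : (2 : ℝ) ≤ q := by exact_mod_cast (Nat.mem_primesLE.1 hq).2.two_le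
  have h1 : Real.log q ≤ 2 * √q := by
    have := Real.log_le_self (Real.sqrt_nonneg (q : ℝ))
    rw [Real.log_sqrt (by linarith)] at this
    linarith
  have h2 : (q : ℝ) ^ (3 / 2 : ℝ) = q * √q := by
    rw [Real.sqrt_eq_rpow, ← Real.rpow_one_add' (by linarith) (by norm_num)]
    norm_num
  have h3 : √(q : ℝ) * √q = q := Real.mul_self_sqrt (by linarith)
  have h4 : 0 < √(q : ℝ) := Real.sqrt_pos.2 (by linarith)
  rw [h2, mul_one_div, div_le_div_iff₀ (by nlinarith) (by positivity)]
  calc Real.log q * (q * √q) ≤ 2 * √q * (q * √q) := by gcongr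
    _ = 2 * q * (√q * √q) := by ring
    _ = 4 * (q * (q / 2)) := by rw [h3]; ring
    _ ≤ 4 * (q * (q - 1)) := by gcongr; linarith

/-- Mertens' first theorem. -/
theorem exists_abs_sum_log_div_sub_log_le :
    ∃ C : ℝ, 1 ≤ C ∧ ∀ n : ℕ, 0 < n →
      |∑ q ∈ Nat.primesLE n, Real.log q / q - Real.log n| ≤ C := by
  obtain ⟨C, hC⟩ := exists_sum_log_div_mul_pred_le
  have hC0 : 0 ≤ C := by simpa using hC 0
  have hlog4 : 0 ≤ Real.log 4 := Real.log_nonneg (by norm_num)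
  refine ⟨1 + C + Real.log 4, by linarith, fun n hn => ?_⟩
  have hn0 : (0 : ℝ) < n := Nat.cast_pos.2 hn
  have hfac := log_factorial_eq_sum n
  rw [abs_le]
  constructor
  · have h1 : (n : ℝ) * Real.log n - n ≤ Real.log (n.factorial : ℕ) := by
      have h2 := Stirling.le_log_factorial_stirling hn.ne'
      have h3 : 0 ≤ Real.log n := Real.log_nonneg (by exact_mod_cast hn)
      have h4 : 0 ≤ Real.log (2 * Real.pi) := Real.log_nonneg (by linarith [Real.pi_gt_three])
      linarith
    have h2 : Real.log (n.factorial : ℕ) ≤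
        n * (∑ q ∈ Nat.primesLE n, Real.log q / q +
          ∑ q ∈ Nat.primesLE n, Real.log q / (q * (q - 1))) := by
      rw [hfac, ← sum_add_distrib, mul_sum]
      refine sum_le_sum fun q hq => ?_
      have hq := (Nat.mem_primesLE.1 hq).2
      have hq2 : (2 : ℝ) ≤ q := by exact_mod_cast hq.two_le
      have h3 : (n.factorial.factorization q : ℝ) ≤ n / (q - 1) := by
        refine (Nat.cast_le.2 (Nat.factorization_factorial_le_div_pred hq n)).trans ?_
        refine Nat.cast_div_le.trans (le_of_eq ?_)
        rw [Nat.cast_sub hq.one_le]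
        simp
      calc _ ≤ n / (q - 1) * Real.log q := by
            gcongr
        _ = _ := by
            have : (q : ℝ) - 1 ≠ 0 := by linarith
            field_simp
            ring
    have h3 : (n : ℝ) * Real.log n - n ≤ n * (∑ q ∈ Nat.primesLE n, Real.log q / q + C) :=
      h1.trans (h2.trans (by gcongr; exact hC n))
    have h4 : n * (Real.log n - 1) ≤ n * (∑ q ∈ Nat.primesLE n, Real.log q / q + C) := by linarith
    linarith [le_of_mul_le_mul_left h4 hn0]
  · have h1 : Real.log (n.factorial : ℕ) ≤ n * Real.log n := by
      rw [← Real.log_pow]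
      refine Real.log_le_log (by exact_mod_cast n.factorial_pos) ?_
      exact_mod_cast Nat.factorial_le_pow n
    have h2 : n * ∑ q ∈ Nat.primesLE n, Real.log q / q - Chebyshev.theta n ≤
        Real.log (n.factorial : ℕ) := by
      rw [hfac, Chebyshev.theta_eq_sum_primesLE_log, mul_sum, ← sum_sub_distrib]
      refine sum_le_sum fun q hq => ?_
      have hq' := (Nat.mem_primesLE.1 hq).2
      have hq2 : (2 : ℝ) ≤ q := by exact_mod_cast hq'.two_le
      have h3 : n / q ≤ n.factorial.factorization q := by
        rw [Nat.factorization_factorial hq' (Nat.lt_succ_self _)]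
        have h4 : 1 ∈ Ico 1 (Nat.log q n).succ := by
          rw [mem_Ico]
          refine ⟨le_rfl, Nat.succ_lt_succ ?_⟩
          exact Nat.log_pos hq'.one_lt (Nat.mem_primesLE.1 hq).1
        simpa using single_le_sum (f := fun i => n / q ^ i) (fun _ _ => Nat.zero_le _) h4
      have h5 : (n : ℝ) / q - 1 ≤ n.factorial.factorization q := by
        have h6 : (n : ℝ) / q - 1 < (n / q : ℕ) := div_sub_one_lt_natCast_div n q
        have : ((n / q : ℕ) : ℝ) ≤ n.factorial.factorization q := by exact_mod_cast h3
        linarith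
      calc n * (Real.log q / q) - Real.log q = (n / q - 1) * Real.log q := by ring
        _ ≤ _ := by
          gcongr
    have h3 := Chebyshev.theta_le_log4_mul_x hn0.le
    have h4 : n * ∑ q ∈ Nat.primesLE n, Real.log q / q ≤ n * (Real.log n + Real.log 4) := by
      linarith
    linarith [le_of_mul_le_mul_left h4 hn0]

end Mertens

section Mertens

open Finset Filter

lemma primesLE_succ_filter_sum {y x : ℕ} (hyx : y ≤ x) (g : ℕ → ℝ) :
    ∑ q ∈ Nat.primesLE (x + 1) with y < q, g q = ∑ q ∈ Nat.primesLE x with y < q, g q +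
      (∑ q ∈ Nat.primesLE (x + 1), (Real.log q / q) - ∑ q ∈ Nat.primesLE x, (Real.log q / q)) *
        (((x + 1 : ℕ) : ℝ) / Real.log (x + 1 : ℕ) * g (x + 1)) := by
  have hmem : ∀ q, q ∈ Nat.primesLE (x + 1) ↔
      q ∈ Nat.primesLE x ∨ (q = x + 1 ∧ (x + 1).Prime) := by
    intro q
    rw [Nat.mem_primesLE, Nat.mem_primesLE]
    constructor
    · rintro ⟨h1, h2⟩
      rcases Nat.lt_or_ge x q with h | h
      · obtain rfl : q = x + 1 := by omega
        exact Or.inr ⟨rfl, h2⟩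
      · exact Or.inl ⟨h, h2⟩
    · rintro (⟨h1, h2⟩ | ⟨rfl, h2⟩)
      · exact ⟨by omega, h2⟩
      · exact ⟨le_rfl, h2⟩
  have hnot : x + 1 ∉ Nat.primesLE x := fun h => by
    have := (Nat.mem_primesLE.1 h).1
    omega
  by_cases hp : (x + 1).Prime
  · have h1 : Nat.primesLE (x + 1) = insert (x + 1) (Nat.primesLE x) := by
      ext q
      rw [hmem, mem_insert]
      tauto
    have hx0 : ((x + 1 : ℕ) : ℝ) ≠ 0 := by positivity
    have hl0 : Real.log ((x + 1 : ℕ) : ℝ) ≠ 0 :=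
      (Real.log_pos (by exact_mod_cast hp.one_lt)).ne'
    rw [h1, filter_insert, if_pos (by omega), sum_insert hnot, sum_insert (by simp [hnot])]
    field_simp
    ring
  · have h1 : Nat.primesLE (x + 1) = Nat.primesLE x := by
      ext q
      rw [hmem]
      tauto
    rw [h1]
    simp

/-- The upper bound in Mertens' second theorem. -/
theorem exists_sum_inv_primes_le :
    ∃ C : ℝ, 0 ≤ C ∧ ∀ y x : ℕ, 2 ≤ y → y ≤ x →
      ∑ q ∈ Nat.primesLE x with y < q, (q : ℝ)⁻¹ ≤
        Real.log (Real.log x) - Real.log (Real.log y) + C / Real.log y := by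
  obtain ⟨C, hC1, hC⟩ := exists_abs_sum_log_div_sub_log_le
  set R : ℕ → ℝ := fun n => ∑ q ∈ Nat.primesLE n, Real.log q / q - Real.log n with hR
  have hlog : ∀ n : ℕ, 2 ≤ n → 0 < Real.log n := fun n hn =>
    Real.log_pos (by exact_mod_cast hn)
  refine ⟨2 * C, by linarith, fun y x hy hyx => ?_⟩
  have key : ∑ q ∈ Nat.primesLE x with y < q, (q : ℝ)⁻¹ ≤
      Real.log (Real.log x) - Real.log (Real.log y) + R x / Real.log x +
        C / Real.log y + C * (1 / Real.log y - 1 / Real.log x) := by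
    induction x, hyx using Nat.le_induction with
    | base =>
      have h1 : {q ∈ Nat.primesLE y | y < q} = ∅ := by
        refine filter_eq_empty_iff.2 fun q hq => ?_
        have := (Nat.mem_primesLE.1 hq).1
        omega
      rw [h1, sum_empty]
      have h2 : 0 ≤ (R y + C) / Real.log y :=
        div_nonneg (by linarith [(abs_le.1 (hC y (by omega))).1]) (hlog y hy).le
      rw [add_div] at h2
      linarith
    | succ x hyx ih =>
      have h1 := hlog x (by omega)
      have h2 := hlog (x + 1) (by omega)
      have h3 : Real.log x ≤ Real.log (x + 1 : ℕ) :=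
        Real.log_le_log (by exact_mod_cast (by omega : 0 < x)) (by push_cast; linarith)
      have h4 : 1 / Real.log (x + 1 : ℕ) ≤ 1 / Real.log x := one_div_le_one_div_of_le h1 h3
      have h5 : R x ≤ C := (abs_le.1 (hC x (by omega))).2
      have h6 : R x * (1 / Real.log x - 1 / Real.log (x + 1 : ℕ)) ≤
          C * (1 / Real.log x - 1 / Real.log (x + 1 : ℕ)) := by gcongr
      have h7 : 1 - Real.log x / Real.log (x + 1 : ℕ) ≤
          Real.log (Real.log (x + 1 : ℕ)) - Real.log (Real.log x) := by
        have := Real.log_le_sub_one_of_pos (div_pos h1 h2)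
        rw [Real.log_div h1.ne' h2.ne'] at this
        linarith
      rw [primesLE_succ_filter_sum hyx]
      have h8 : (∑ q ∈ Nat.primesLE (x + 1), (Real.log q / q) -
          ∑ q ∈ Nat.primesLE x, (Real.log q / q)) *
            (((x + 1 : ℕ) : ℝ) / Real.log (x + 1 : ℕ) * ((x + 1 : ℕ) : ℝ)⁻¹) =
          1 - Real.log x / Real.log (x + 1 : ℕ) + (R (x + 1) - R x) / Real.log (x + 1 : ℕ) := by
        have hx0 : ((x + 1 : ℕ) : ℝ) ≠ 0 := by positivity
        simp only [hR]
        field_simp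
        ring
      rw [h8]
      have h9 : (R (x + 1) - R x) / Real.log (x + 1 : ℕ) =
        R (x + 1) / Real.log (x + 1 : ℕ) - R x * (1 / Real.log (x + 1 : ℕ)) := by ring
      have h10 : R x / Real.log x = R x * (1 / Real.log x) := by ring
      rw [h9]
      rw [h10] at ih
      linarith
  refine key.trans ?_
  have h1 : R x ≤ C := (abs_le.1 (hC x (by omega))).2
  have h2 := div_le_div_of_nonneg_right h1 (hlog x (by omega)).le
  have h3 : C * (1 / Real.log y - 1 / Real.log x) = C / Real.log y - C / Real.log x := by ring
  have h4 : 2 * C / Real.log y = C / Real.log y + C / Real.log y := by ring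
  linarith

lemma exists_sum_inv_primes_mul_log_ge :
    ∃ C : ℝ, ∀ y x : ℕ, 0 < y → y ≤ x →
      Real.log x - Real.log y - C ≤
        (∑ q ∈ Nat.primesLE x with y < q, (q : ℝ)⁻¹) * Real.log x := by
  obtain ⟨C, hC1, hC⟩ := exists_abs_sum_log_div_sub_log_le
  refine ⟨2 * C, fun y x hy hyx => ?_⟩
  have h1 := (abs_le.1 (hC y hy)).2
  have h2 := (abs_le.1 (hC x (by omega))).1
  have h3 : {q ∈ Nat.primesLE x | ¬ y < q} = Nat.primesLE y := by
    ext q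
    simp only [mem_filter, Nat.mem_primesLE]
    constructor
    · rintro ⟨⟨-, h⟩, h'⟩
      exact ⟨by omega, h⟩
    · rintro ⟨h, h'⟩
      exact ⟨⟨by omega, h'⟩, by omega⟩
  rw [← sum_filter_add_sum_filter_not _ (y < ·), h3] at h2
  rw [sum_mul]
  have h4 : ∑ q ∈ Nat.primesLE x with y < q, Real.log q / q ≤
      ∑ q ∈ Nat.primesLE x with y < q, (q : ℝ)⁻¹ * Real.log x := by
    refine sum_le_sum fun q hq => ?_
    obtain ⟨hqx, hq⟩ := Nat.mem_primesLE.1 (mem_filter.1 hq).1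
    rw [div_eq_inv_mul]
    gcongr
    exact_mod_cast hq.pos
  linarith

lemma exists_sum_inv_primes_window_le :
    ∃ C : ℝ, 0 < C ∧ ∀ d : ℕ, 2 ≤ d →
      ∑ e ∈ Nat.primesLE (d ^ 3) with d < e ^ 3, (e : ℝ)⁻¹ ≤ C := by
  obtain ⟨C, hC1, hC⟩ := exists_abs_sum_log_div_sub_log_le
  have hl2 : 0 < Real.log 2 := Real.log_pos one_lt_two
  refine ⟨9 + 3 * C / Real.log 2, by positivity, fun d hd => ?_⟩
  have hd2 : (2 : ℝ) ≤ d := by exact_mod_cast hd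
  have h1 := (abs_le.1 (hC (d ^ 3) (by positivity))).2
  have hld : Real.log 2 ≤ Real.log d := Real.log_le_log two_pos hd2
  have hld0 := hl2.trans_le hld
  have h2 : (∑ e ∈ Nat.primesLE (d ^ 3) with d < e ^ 3, (e : ℝ)⁻¹) * Real.log d ≤
      3 * ∑ e ∈ Nat.primesLE (d ^ 3), Real.log e / e := by
    rw [sum_mul, mul_sum]
    refine le_trans (sum_le_sum fun e he => ?_) (sum_le_sum_of_subset_of_nonneg
      (filter_subset _ _) fun e he _ => ?_)
    · obtain ⟨he1, he2⟩ := mem_filter.1 he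
      have : Real.log d ≤ 3 * Real.log e := by
        have h3 : (d : ℝ) ≤ (e : ℝ) ^ 3 := by exact_mod_cast he2.le
        have := Real.log_le_log (by linarith) h3
        rw [Real.log_pow] at this
        exact_mod_cast this
      calc (e : ℝ)⁻¹ * Real.log d ≤ (e : ℝ)⁻¹ * (3 * Real.log e) := by gcongr
        _ = _ := by ring
    · have : (1 : ℝ) ≤ e := by exact_mod_cast (Nat.mem_primesLE.1 he).2.one_le
      have := Real.log_nonneg this
      positivity
  have h3 : Real.log ((d ^ 3 : ℕ) : ℝ) = 3 * Real.log d := by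
    push_cast
    rw [Real.log_pow]
    norm_num
  rw [h3] at h1
  refine le_of_mul_le_mul_right (h2.trans ?_) hld0
  have h4 : 3 * C ≤ 3 * C / Real.log 2 * Real.log d := by
    rw [div_mul_eq_mul_div, le_div_iff₀ hl2]
    gcongr
  linarith

lemma exists_primeCounting_floor_le :
    ∃ C : ℝ, 0 < C ∧ ∀ y : ℝ, 1 < y → (Nat.primeCounting ⌊y⌋₊ : ℝ) ≤ C * (y / Real.log y) := by
  have hl4 : 0 < Real.log 4 := Real.log_pos (by norm_num)
  refine ⟨2 * Real.log 4 + 2, by positivity, fun y hy => ?_⟩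
  have hy0 : 0 < y := by linarith
  have hl := Real.log_pos hy
  have h1 := Chebyshev.pi_le_log4_mul_div hy
  rw [Real.log_sqrt hy0.le] at h1
  have h2 : √y ≤ 2 * (y / Real.log y) := by
    rw [← mul_div_assoc, le_div_iff₀ hl]
    have h3 := Real.log_le_self (Real.sqrt_nonneg y)
    rw [Real.log_sqrt hy0.le] at h3
    calc √y * Real.log y ≤ √y * (2 * √y) := by gcongr; linarith
      _ = 2 * (√y * √y) := by ring
      _ = 2 * y := by rw [Real.mul_self_sqrt hy0.le]
  have h3 : Real.log 4 * y / (Real.log y / 2) = 2 * Real.log 4 * (y / Real.log y) := by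
    field_simp
  rw [h3] at h1
  linarith

lemma exists_primeCounting_sub_ge :
    ∃ K n₀ : ℕ, 2 ≤ K ∧ 2 ≤ n₀ ∧ ∀ n, n₀ ≤ n →
      (n : ℝ) / (8 * Real.log n) ≤ Nat.primeCounting n - Nat.primeCounting (n / K) := by
  obtain ⟨C, hC0, hC⟩ := exists_primeCounting_floor_le
  obtain ⟨n₁, hn₁⟩ := eventually_atTop.1 eventually_div_log_le_primeCounting
  obtain ⟨K, hK⟩ : ∃ K : ℕ, max 2 (16 * C) ≤ K := exists_nat_ge _
  have hK2 : (2 : ℝ) ≤ K := (le_max_left _ _).trans hK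
  have hKC : 16 * C ≤ K := (le_max_right _ _).trans hK
  refine ⟨K, max 2 (max n₁ (K ^ 2)), by exact_mod_cast hK2, le_max_left _ _, fun n hn => ?_⟩
  have hn1 : n₁ ≤ n := ((le_max_left _ _).trans (le_max_right _ _)).trans hn
  have hnK : K ^ 2 ≤ n := ((le_max_right _ _).trans (le_max_right _ _)).trans hn
  have hnK' : (K : ℝ) ^ 2 ≤ n := by exact_mod_cast hnK
  have hK0 : (0 : ℝ) < K := by linarith
  have hn0 : (0 : ℝ) < n := (pow_pos hK0 2).trans_le hnK'
  have h1 := hn₁ n hn1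
  have hnK1 : (K : ℝ) ≤ n / K := by
    rw [le_div_iff₀ hK0]
    linarith
  have hlogK : 0 < Real.log K := Real.log_pos (by linarith)
  have h2 : Real.log n ≤ 2 * Real.log (n / K) := by
    have h3 := Real.log_le_log hK0 hnK1
    rw [Real.log_div hn0.ne' hK0.ne'] at *
    linarith
  have hlogn : 0 < Real.log n := by
    have := Real.log_le_log hK0 hnK1
    rw [Real.log_div hn0.ne' hK0.ne'] at this
    linarith
  have h3 := hC (n / K) (by linarith)
  rw [Nat.floor_div_eq_div] at h3
  have h4 : C * (n / K / Real.log (n / K)) ≤ n / (8 * Real.log n) := by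
    have h5 : 0 < Real.log (n / K) := by linarith
    calc C * (n / K / Real.log (n / K)) = (16 * C) * (n / (16 * K * Real.log (n / K))) := by
          field_simp
      _ ≤ K * (n / (16 * K * Real.log (n / K))) := by gcongr
      _ = n / (8 * (2 * Real.log (n / K))) := by field_simp; norm_num
      _ ≤ _ := by gcongr
  have h5 : (n : ℝ) / (4 * Real.log n) = n / (8 * Real.log n) + n / (8 * Real.log n) := by
    field_simp
    norm_num
  linarith

end Mertens

section SecondMoment

open Finset

lemma card_filter_dvd_and_dvd_le {d e : ℕ} (hd : 0 < d) (he : 0 < e) (N : ℕ) :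
    (#{n ∈ Icc 1 N | d ∣ n ∧ e ∣ n} : ℝ) ≤ N * (Nat.gcd d e / (d * e)) := by
  have h1 : {n ∈ Icc 1 N | d ∣ n ∧ e ∣ n} = {n ∈ Ioc 0 N | Nat.lcm d e ∣ n} := by
    ext n
    simp only [mem_filter, mem_Icc, mem_Ioc, Nat.lcm_dvd_iff]
    rfl
  rw [h1, Nat.Ioc_filter_dvd_card_eq_div]
  refine Nat.cast_div_le.trans (le_of_eq ?_)
  have h2 : (Nat.gcd d e : ℝ) * Nat.lcm d e = d * e := by exact_mod_cast Nat.gcd_mul_lcm d e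
  have h3 : (Nat.gcd d e : ℝ) ≠ 0 := by exact_mod_cast (Nat.gcd_pos_of_pos_left e hd).ne'
  rw [← h2]
  field_simp

lemma sum_sq_sum_dvd_le {ι : Type*} (V : Finset ι) (d : ι → ℕ) (c : ι → ℝ)
    (hd : ∀ v ∈ V, 0 < d v) (hc : ∀ v ∈ V, 0 ≤ c v) (N : ℕ) :
    ∑ n ∈ Icc 1 N, (∑ v ∈ V, if d v ∣ n then c v else 0) ^ 2 ≤
      N * ∑ v ∈ V, ∑ u ∈ V, c v * c u * (Nat.gcd (d v) (d u) / (d v * d u)) := by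
  have h1 : ∑ n ∈ Icc 1 N, (∑ v ∈ V, if d v ∣ n then c v else 0) ^ 2 =
      ∑ v ∈ V, ∑ u ∈ V, c v * c u * (#{n ∈ Icc 1 N | d v ∣ n ∧ d u ∣ n} : ℝ) := by
    simp only [pow_two, sum_mul_sum]
    rw [sum_comm]
    refine sum_congr rfl fun v _ => ?_
    rw [sum_comm]
    refine sum_congr rfl fun u _ => ?_
    rw [card_filter, Nat.cast_sum, mul_sum]
    refine sum_congr rfl fun n _ => ?_
    by_cases h1 : d v ∣ n <;> by_cases h2 : d u ∣ n <;> simp [h1, h2]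
  rw [h1, mul_sum]
  refine sum_le_sum fun v hv => ?_
  rw [mul_sum]
  refine sum_le_sum fun u hu => ?_
  calc _ ≤ c v * c u * (N * (Nat.gcd (d v) (d u) / (d v * d u))) :=
        mul_le_mul_of_nonneg_left (card_filter_dvd_and_dvd_le (hd v hv) (hd u hu) N)
          (mul_nonneg (hc v hv) (hc u hu))
    _ = _ := by ring

lemma gcd_mul_prime_le {a b : ℕ} (ha : a.Prime) (hb : b.Prime) (n : ℕ) :
    Nat.gcd (a * b) n ≤ 1 + (if a ∣ n then a else 0) + (if b ∣ n then b else 0) +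
      (if a * b ∣ n then a * b else 0) := by
  have hn : Nat.gcd (a * b) n ∣ n := Nat.gcd_dvd_right _ _
  obtain ⟨k, l, hk, hl, hkl⟩ := (Nat.dvd_mul).1 (Nat.gcd_dvd_left (a * b) n)
  rw [← hkl] at hn ⊢
  rcases (Nat.dvd_prime ha).1 hk with rfl | rfl <;> rcases (Nat.dvd_prime hb).1 hl with rfl | rfl
  · simp only [mul_one]
    omega
  · simp only [one_mul] at hn ⊢
    rw [if_pos hn]
    omega
  · simp only [mul_one] at hn ⊢
    rw [if_pos hn]
    omega
  · rw [if_pos hn]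
    omega

/-- Second moment of a weighted count of divisors that are products of two primes of comparable
logarithm. -/
lemma sum_sq_sum_semiprime_dvd_le {C₃ : ℝ}
    (hC₃ : ∀ d : ℕ, 2 ≤ d → ∑ e ∈ Nat.primesLE (d ^ 3) with d < e ^ 3, (e : ℝ)⁻¹ ≤ C₃)
    (V : Finset (ℕ × ℕ)) (hV : ∀ v ∈ V, v.1.Prime ∧ v.2.Prime ∧ v.1 < v.2 ∧ v.2 < v.1 ^ 3)
    (c : ℕ × ℕ → ℝ) {C M : ℝ} (hc0 : ∀ v, 0 ≤ c v) (hcC : ∀ v, c v ≤ C)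
    (hM : ∑ v ∈ V, c v / (v.1 * v.2) ≤ M) (N : ℕ) :
    ∑ n ∈ Icc 1 N, (∑ v ∈ V, if v.1 * v.2 ∣ n then c v else 0) ^ 2 ≤
      N * (M * (M + 4 * C * C₃ + C)) := by
  have hC0 : 0 ≤ C := (hc0 (0, 0)).trans (hcC _)
  have hpos : ∀ v ∈ V, 0 < v.1 * v.2 := fun v hv =>
    Nat.mul_pos (hV v hv).1.pos (hV v hv).2.1.pos
  have hprime : ∀ d : ℕ, d.Prime →
      ∑ u ∈ V, (if d ∣ u.1 * u.2 then (d : ℝ) else 0) * (c u / (u.1 * u.2)) ≤ 2 * C * C₃ := by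
    intro d hd
    have hd0 : (0 : ℝ) < d := Nat.cast_pos.2 hd.pos
    have h1 : ∀ u ∈ V, (if d ∣ u.1 * u.2 then (d : ℝ) else 0) * (c u / (u.1 * u.2)) ≤
        C * (if u.1 = d then (u.2 : ℝ)⁻¹ else 0) + C * (if u.2 = d then (u.1 : ℝ)⁻¹ else 0) := by
      intro u hu
      obtain ⟨hu1, hu2, hlt, -⟩ := hV u hu
      have hu10 : (0 : ℝ) < u.1 := Nat.cast_pos.2 hu1.pos
      have hu20 : (0 : ℝ) < u.2 := Nat.cast_pos.2 hu2.pos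
      by_cases h : d ∣ u.1 * u.2
      · rw [if_pos h]
        rcases (Nat.Prime.dvd_mul hd).1 h with h | h
        · rw [Nat.prime_dvd_prime_iff_eq hd hu1] at h
          rw [if_pos h.symm, if_neg (by omega), h]
          calc (u.1 : ℝ) * (c u / (u.1 * u.2)) = c u * (u.2 : ℝ)⁻¹ := by field_simp
            _ ≤ C * (u.2 : ℝ)⁻¹ := by gcongr; exact hcC u
            _ = _ := by ring
        · rw [Nat.prime_dvd_prime_iff_eq hd hu2] at h
          rw [if_pos h.symm, if_neg (by omega), h]
          calc (u.2 : ℝ) * (c u / (u.1 * u.2)) = c u * (u.1 : ℝ)⁻¹ := by field_simp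
            _ ≤ C * (u.1 : ℝ)⁻¹ := by gcongr; exact hcC u
            _ = _ := by ring
      · rw [if_neg h, zero_mul]
        split_ifs <;> positivity
    have h2 : ∑ u ∈ V, (if u.1 = d then (u.2 : ℝ)⁻¹ else 0) ≤ C₃ := by
      refine le_trans ?_ (hC₃ d hd.two_le)
      rw [← sum_filter, ← sum_image (f := fun e : ℕ => (e : ℝ)⁻¹) (g := Prod.snd)]
      · refine sum_le_sum_of_subset_of_nonneg (fun e he => ?_) fun _ _ _ => by positivity
        obtain ⟨u, hu, rfl⟩ := mem_image.1 he
        obtain ⟨huV, rfl⟩ := mem_filter.1 hu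
        obtain ⟨hu1, hu2, hlt, hlt3⟩ := hV u huV
        refine mem_filter.2 ⟨Nat.mem_primesLE.2 ⟨hlt3.le, hu2⟩, ?_⟩
        exact hlt.trans_le (Nat.le_self_pow (by norm_num) _)
      · intro u hu v hv h
        exact Prod.ext ((mem_filter.1 hu).2.trans (mem_filter.1 hv).2.symm) h
    have h3 : ∑ u ∈ V, (if u.2 = d then (u.1 : ℝ)⁻¹ else 0) ≤ C₃ := by
      refine le_trans ?_ (hC₃ d hd.two_le)
      rw [← sum_filter, ← sum_image (f := fun e : ℕ => (e : ℝ)⁻¹) (g := Prod.fst)]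
      · refine sum_le_sum_of_subset_of_nonneg (fun e he => ?_) fun _ _ _ => by positivity
        obtain ⟨u, hu, rfl⟩ := mem_image.1 he
        obtain ⟨huV, rfl⟩ := mem_filter.1 hu
        obtain ⟨hu1, hu2, hlt, hlt3⟩ := hV u huV
        refine mem_filter.2 ⟨Nat.mem_primesLE.2 ⟨?_, hu1⟩, hlt3⟩
        exact hlt.le.trans (Nat.le_self_pow (by norm_num) _)
      · intro u hu v hv h
        exact Prod.ext h ((mem_filter.1 hu).2.trans (mem_filter.1 hv).2.symm)
    refine (sum_le_sum h1).trans ?_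
    rw [sum_add_distrib, ← mul_sum, ← mul_sum]
    have h4 := mul_le_mul_of_nonneg_left h2 hC0
    have h5 := mul_le_mul_of_nonneg_left h3 hC0
    linarith
  have hpair : ∀ v ∈ V, ∑ u ∈ V,
      (if v.1 * v.2 ∣ u.1 * u.2 then (v.1 * v.2 : ℝ) else 0) * (c u / (u.1 * u.2)) ≤ C := by
    intro v hv
    obtain ⟨hv1, hv2, hvlt, -⟩ := hV v hv
    have h1 : ∀ u ∈ V, (if v.1 * v.2 ∣ u.1 * u.2 then (v.1 * v.2 : ℝ) else 0) *
        (c u / (u.1 * u.2)) = if u = v then c v else 0 := by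
      intro u hu
      obtain ⟨hu1, hu2, hult, -⟩ := hV u hu
      have hu10 : (u.1 : ℝ) ≠ 0 := Nat.cast_ne_zero.2 hu1.ne_zero
      have hu20 : (u.2 : ℝ) ≠ 0 := Nat.cast_ne_zero.2 hu2.ne_zero
      by_cases h : v.1 * v.2 ∣ u.1 * u.2
      · have ha := (Nat.Prime.dvd_mul hv1).1 ((dvd_mul_right _ _).trans h)
        have hb := (Nat.Prime.dvd_mul hv2).1 ((dvd_mul_left _ _).trans h)
        rw [Nat.prime_dvd_prime_iff_eq hv1 hu1, Nat.prime_dvd_prime_iff_eq hv1 hu2] at ha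
        rw [Nat.prime_dvd_prime_iff_eq hv2 hu1, Nat.prime_dvd_prime_iff_eq hv2 hu2] at hb
        have huv : u = v := Prod.ext (by omega) (by omega)
        rw [if_pos h, if_pos huv, huv]
        rw [huv] at hu10 hu20
        field_simp
      · rw [if_neg h, zero_mul, if_neg]
        rintro rfl
        exact h dvd_rfl
    rw [sum_congr rfl h1, sum_ite_eq' V v, if_pos hv]
    exact hcC v
  refine (sum_sq_sum_dvd_le V (fun v => v.1 * v.2) c hpos (fun v _ => hc0 v) N).trans ?_
  refine mul_le_mul_of_nonneg_left ?_ (Nat.cast_nonneg N)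
  have hM0 : 0 ≤ ∑ v ∈ V, c v / (v.1 * v.2) := sum_nonneg fun v _ =>
    div_nonneg (hc0 v) (by positivity)
  have hrow : ∀ v ∈ V, ∑ u ∈ V, c v * c u *
      (Nat.gcd (v.1 * v.2) (u.1 * u.2) / ((v.1 * v.2 : ℕ) * (u.1 * u.2 : ℕ))) ≤
      c v / (v.1 * v.2) * (M + 4 * C * C₃ + C) := by
    intro v hv
    obtain ⟨hv1, hv2, -, -⟩ := hV v hv
    have h1 : ∀ u ∈ V, c v * c u *
        (Nat.gcd (v.1 * v.2) (u.1 * u.2) / ((v.1 * v.2 : ℕ) * (u.1 * u.2 : ℕ))) ≤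
        c v / (v.1 * v.2) * (c u / (u.1 * u.2) +
          (if v.1 ∣ u.1 * u.2 then (v.1 : ℝ) else 0) * (c u / (u.1 * u.2)) +
          (if v.2 ∣ u.1 * u.2 then (v.2 : ℝ) else 0) * (c u / (u.1 * u.2)) +
          (if v.1 * v.2 ∣ u.1 * u.2 then (v.1 * v.2 : ℝ) else 0) * (c u / (u.1 * u.2))) := by
      intro u _
      have h2 : (Nat.gcd (v.1 * v.2) (u.1 * u.2) : ℝ) ≤
          1 + (if v.1 ∣ u.1 * u.2 then (v.1 : ℝ) else 0) +
          (if v.2 ∣ u.1 * u.2 then (v.2 : ℝ) else 0) +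
          (if v.1 * v.2 ∣ u.1 * u.2 then (v.1 * v.2 : ℝ) else 0) := by
        exact_mod_cast gcd_mul_prime_le hv1 hv2 (u.1 * u.2)
      have h3 : 0 ≤ c v / (v.1 * v.2) * (c u / (u.1 * u.2)) :=
        mul_nonneg (div_nonneg (hc0 v) (by positivity)) (div_nonneg (hc0 u) (by positivity))
      have h4 := mul_le_mul_of_nonneg_left h2 h3
      refine le_trans (le_of_eq ?_) (h4.trans (le_of_eq ?_))
      · push_cast
        ring
      · ring
    refine (sum_le_sum h1).trans ?_
    rw [← mul_sum]
    refine mul_le_mul_of_nonneg_left ?_ (div_nonneg (hc0 v) (by positivity))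
    simp only [sum_add_distrib]
    linarith [hprime v.1 hv1, hprime v.2 hv2, hpair v hv]
  refine (sum_le_sum hrow).trans ?_
  rw [← sum_mul]
  have hC₃0 : 0 ≤ C₃ := (sum_nonneg fun _ _ => by positivity).trans (hC₃ 2 le_rfl)
  have hM' := hM0.trans hM
  gcongr

end SecondMoment

section SemiprimePairs

open Finset Filter

/-- Pairs of primes `(a, b)` outside `P` with `q ^ (1/4) < a ≤ q ^ (1/3)`, `q ^ (1/4) < b` and
`q / K < a * b ≤ q`. -/
def semiprimePairs (P : ℕ → Prop) [DecidablePred P] (K q : ℕ) : Finset (ℕ × ℕ) :=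
  {v ∈ Nat.primesLE q ×ˢ Nat.primesLE q | (¬P v.1 ∧ ¬P v.2) ∧
    q < v.1 ^ 4 ∧ q < v.2 ^ 4 ∧ v.1 ^ 3 ≤ q ∧ v.1 * v.2 ≤ q ∧ q < K * (v.1 * v.2)}

lemma lt_and_lt_pow_of_mem_semiprimePairs {P : ℕ → Prop} [DecidablePred P] {K q : ℕ}
    (hq : K ^ 4 ≤ q) {v : ℕ × ℕ} (hv : v ∈ semiprimePairs P K q) :
    v.1 < v.2 ∧ v.2 < v.1 ^ 3 := by
  obtain ⟨-, -, h1, -, h2, h3, h4⟩ := mem_filter.1 hv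
  have ha : 0 < v.1 := by
    rcases Nat.eq_zero_or_pos v.1 with h | h
    · simp [h] at h1
    · exact h
  constructor
  · by_contra! h
    have h5 : K < v.1 := lt_of_pow_lt_pow_left₀ 4 (Nat.zero_le _) (hq.trans_lt h1)
    have h6 : K * (v.1 * v.2) ≤ v.1 * (v.1 * v.1) :=
      Nat.mul_le_mul h5.le (Nat.mul_le_mul le_rfl h)
    have : v.1 ^ 3 = v.1 * (v.1 * v.1) := by ring
    omega
  · by_contra! h
    have h5 : v.1 * v.1 ^ 3 ≤ v.1 * v.2 := Nat.mul_le_mul le_rfl h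
    have : v.1 ^ 4 = v.1 * v.1 ^ 3 := by ring
    omega

lemma exists_sum_inv_primes_between_roots_ge :
    ∃ q₀ : ℕ, ∀ q ≥ q₀,
      1 / 8 ≤ ∑ a ∈ Nat.primesLE q with a ^ 3 ≤ q ∧ q < a ^ 4, (a : ℝ)⁻¹ := by
  obtain ⟨C, hC⟩ := exists_sum_inv_primes_mul_log_ge
  have hlim : Tendsto (fun n : ℕ => Real.log n) atTop atTop :=
    Real.tendsto_log_atTop.comp tendsto_natCast_atTop_atTop
  obtain ⟨q₀, hq₀⟩ := eventually_atTop.1 (hlim.eventually_ge_atTop (24 * (|C| + Real.log 2)))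
  refine ⟨max q₀ 16, fun q hq => ?_⟩
  have hq16 : 16 ≤ q := (le_max_right _ _).trans hq
  have hlog := hq₀ q ((le_max_left _ _).trans hq)
  obtain ⟨m, hm⟩ : ∃ m, m = Nat.nthRoot 3 q := ⟨_, rfl⟩
  obtain ⟨n, hn⟩ : ∃ n, n = Nat.nthRoot 4 q := ⟨_, rfl⟩
  have hm1 : m ^ 3 ≤ q := hm ▸ Nat.pow_nthRoot_le (by norm_num)
  have hm2 : q < (m + 1) ^ 3 := hm ▸ Nat.lt_pow_nthRoot_add_one (by norm_num) q
  have hn1 : n ^ 4 ≤ q := hn ▸ Nat.pow_nthRoot_le (by norm_num)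
  have hn2 : q < (n + 1) ^ 4 := hn ▸ Nat.lt_pow_nthRoot_add_one (by norm_num) q
  have hn0 : 0 < n := by
    rcases Nat.eq_zero_or_pos n with h | h
    · subst h
      simp only [zero_add, one_pow] at hn2
      omega
    · exact h
  have hnm : n ≤ m := by
    by_contra! h
    have h1 : (m + 1) ^ 3 ≤ n ^ 3 := Nat.pow_le_pow_left h 3
    have h2 : n ^ 3 ≤ n ^ 4 := Nat.pow_le_pow_right hn0 (by norm_num)
    omega
  have hm0 : 0 < m := hn0.trans_le hnm
  have hmR : (0 : ℝ) < m := Nat.cast_pos.2 hm0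
  have hnR : (0 : ℝ) < n := Nat.cast_pos.2 hn0
  have hqR : (0 : ℝ) < q := Nat.cast_pos.2 (by omega)
  have hlm1 : 3 * Real.log m ≤ Real.log q := by
    have := Real.log_le_log (pow_pos hmR 3) (show (m : ℝ) ^ 3 ≤ q by exact_mod_cast hm1)
    rw [Real.log_pow] at this
    exact_mod_cast this
  have hln1 : 4 * Real.log n ≤ Real.log q := by
    have := Real.log_le_log (pow_pos hnR 4) (show (n : ℝ) ^ 4 ≤ q by exact_mod_cast hn1)
    rw [Real.log_pow] at this
    exact_mod_cast this
  have hlm2 : Real.log q ≤ 3 * (Real.log 2 + Real.log m) := by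
    have h1 : q ≤ (2 * m) ^ 3 := hm2.le.trans (Nat.pow_le_pow_left (by omega) 3)
    have := Real.log_le_log hqR (show (q : ℝ) ≤ (2 * m) ^ 3 by exact_mod_cast h1)
    rw [Real.log_pow, Real.log_mul two_ne_zero hmR.ne'] at this
    exact_mod_cast this
  have h1 := hC n m hn0 hnm
  have h2 : ∑ q ∈ Nat.primesLE m with n < q, (q : ℝ)⁻¹ ≤
      ∑ a ∈ Nat.primesLE q with a ^ 3 ≤ q ∧ q < a ^ 4, (a : ℝ)⁻¹ := by
    refine sum_le_sum_of_subset_of_nonneg (fun a ha => ?_) fun _ _ _ => by positivity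
    obtain ⟨ha1, ha2⟩ := mem_filter.1 ha
    obtain ⟨ha3, ha4⟩ := Nat.mem_primesLE.1 ha1
    have ha5 : a ^ 3 ≤ q := (Nat.pow_le_pow_left ha3 3).trans hm1
    refine mem_filter.2 ⟨Nat.mem_primesLE.2 ⟨(Nat.le_self_pow (by norm_num) a).trans ha5, ha4⟩,
      ha5, hn2.trans_le (Nat.pow_le_pow_left ha2 4)⟩
  refine le_trans ?_ h2
  obtain ⟨S, hS⟩ : ∃ S, S = ∑ q ∈ Nat.primesLE m with n < q, (q : ℝ)⁻¹ := ⟨_, rfl⟩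
  have hS0 : 0 ≤ S := hS ▸ sum_nonneg fun _ _ => by positivity
  rw [← hS] at h1 ⊢
  have h3 : S * Real.log m ≤ S * (Real.log q / 3) :=
    mul_le_mul_of_nonneg_left (by linarith) hS0
  have hCabs := le_abs_self C
  have hl2 : 0 < Real.log 2 := Real.log_pos (by norm_num)
  have hlq : 0 < Real.log q := by
    have := abs_nonneg C
    linarith
  by_contra! h
  have h4 : S * (Real.log q / 3) < 1 / 8 * (Real.log q / 3) :=
    mul_lt_mul_of_pos_right h (by linarith)
  linarith

lemma exists_card_prime_pairs_mem_le :
    ∃ C : ℝ, 0 < C ∧ ∀ (R : Finset ℕ) (q : ℕ), (∀ r ∈ R, 0 < r) →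
      (#{v ∈ R ×ˢ Nat.primesLE q | q < v.2 ^ 4 ∧ v.1 * v.2 ≤ q} : ℝ) ≤
        C * (q / Real.log q) * ∑ r ∈ R, (r : ℝ)⁻¹ := by
  obtain ⟨C, hC0, hC⟩ := exists_primeCounting_floor_le
  refine ⟨4 * C, by positivity, fun R q hR => ?_⟩
  rw [card_filter, sum_product, Nat.cast_sum, mul_sum]
  refine sum_le_sum fun r hr => ?_
  have hr0 : (0 : ℝ) < r := Nat.cast_pos.2 (hR r hr)
  rw [← card_filter]
  rcases ({s ∈ Nat.primesLE q | q < s ^ 4 ∧ r * s ≤ q}).eq_empty_or_nonempty with h | ⟨s, hs⟩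
  · rw [h, card_empty, Nat.cast_zero]
    have := Real.log_natCast_nonneg q
    positivity
  obtain ⟨hs1, hs2, hs3⟩ := mem_filter.1 hs
  have hs4 := (Nat.mem_primesLE.1 hs1).2
  have hsR : (1 : ℝ) < s := by exact_mod_cast hs4.one_lt
  have hqR : (0 : ℝ) < q := Nat.cast_pos.2 ((Nat.mul_pos (hR r hr) hs4.pos).trans_le hs3)
  have hsq : (s : ℝ) ≤ q / r := by
    rw [le_div_iff₀ hr0, mul_comm]
    exact_mod_cast hs3
  have hlq : 0 < Real.log q := by
    refine Real.log_pos ?_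
    exact_mod_cast hs4.one_lt.trans_le (Nat.mem_primesLE.1 hs1).1
  have hlog : Real.log q / 4 ≤ Real.log (q / r) := by
    have h1 := Real.log_le_log (by linarith) hsq
    have h2 := Real.log_le_log hqR (show (q : ℝ) ≤ s ^ 4 by exact_mod_cast hs2.le)
    rw [Real.log_pow] at h2
    push_cast at h2
    linarith
  have h1 := hC (q / r) (hsR.trans_le hsq)
  rw [Nat.floor_div_eq_div] at h1
  have h2 : #{s ∈ Nat.primesLE q | q < s ^ 4 ∧ r * s ≤ q} ≤ Nat.primeCounting (q / r) := by
    rw [← Nat.primesLE_card_eq_primeCounting]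
    refine card_le_card fun t ht => ?_
    obtain ⟨ht1, -, ht2⟩ := mem_filter.1 ht
    refine Nat.mem_primesLE.2 ⟨?_, (Nat.mem_primesLE.1 ht1).2⟩
    rwa [Nat.le_div_iff_mul_le (hR r hr), mul_comm]
  calc _ ≤ (Nat.primeCounting (q / r) : ℝ) := by exact_mod_cast h2
    _ ≤ C * (q / r / Real.log (q / r)) := h1
    _ ≤ C * (q / r / (Real.log q / 4)) := by gcongr
    _ = _ := by field_simp

lemma exists_card_prime_pairs_ge :
    ∃ K q₀ : ℕ, 2 ≤ K ∧ ∀ q ≥ q₀, (q : ℝ) / Real.log q / 128 ≤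
      #{v ∈ Nat.primesLE q ×ˢ Nat.primesLE q |
        q < v.1 ^ 4 ∧ q < v.2 ^ 4 ∧ v.1 ^ 3 ≤ q ∧ v.1 * v.2 ≤ q ∧ q < K * (v.1 * v.2)} := by
  obtain ⟨K, n₀, hK, hn₀, hπ⟩ := exists_primeCounting_sub_ge
  obtain ⟨q₁, hq₁⟩ := exists_sum_inv_primes_between_roots_ge
  refine ⟨K, max q₁ (max (n₀ ^ 4) (K ^ 3)), hK, fun q hq => ?_⟩
  have hqq₁ : q₁ ≤ q := (le_max_left _ _).trans hq
  have hqn₀ : n₀ ^ 4 ≤ q := ((le_max_left _ _).trans (le_max_right _ _)).trans hq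
  have hqK : K ^ 3 ≤ q := ((le_max_right _ _).trans (le_max_right _ _)).trans hq
  have hq0 : 0 < q := (by positivity : 0 < n₀ ^ 4).trans_le hqn₀
  have hsum := hq₁ q hqq₁
  have hlq := Real.log_natCast_nonneg q
  have hterm : ∀ a ∈ ({a ∈ Nat.primesLE q | a ^ 3 ≤ q ∧ q < a ^ 4} : Finset ℕ),
      (q : ℝ) / Real.log q / 16 * (a : ℝ)⁻¹ ≤ #{b ∈ Nat.primesLE q |
        q < a ^ 4 ∧ q < b ^ 4 ∧ a ^ 3 ≤ q ∧ a * b ≤ q ∧ q < K * (a * b)} := by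
    intro a ha
    obtain ⟨ha1, ha3, ha4⟩ := mem_filter.1 ha
    obtain ⟨haq, hap⟩ := Nat.mem_primesLE.1 ha1
    have ha0 : (0 : ℝ) < a := Nat.cast_pos.2 hap.pos
    have han₀ : n₀ ≤ a := (lt_of_pow_lt_pow_left₀ 4 (Nat.zero_le _) (hqn₀.trans_lt ha4)).le
    have haa : a * a ≤ q / a := by
      rw [Nat.le_div_iff_mul_le hap.pos]
      calc a * a * a = a ^ 3 := by ring
        _ ≤ q := ha3
    have hdiv : a ≤ q / a := (Nat.le_mul_self a).trans haa
    have hdiv0 : 0 < q / a := hap.pos.trans_le hdiv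
    have h1 := hπ (q / a) (han₀.trans hdiv)
    have h2 : (Nat.primeCounting (q / a) : ℝ) - Nat.primeCounting (q / a / K) ≤
        #{b ∈ Nat.primesLE q |
          q < a ^ 4 ∧ q < b ^ 4 ∧ a ^ 3 ≤ q ∧ a * b ≤ q ∧ q < K * (a * b)} := by
      rw [sub_le_iff_le_add, ← Nat.primesLE_card_eq_primeCounting,
        ← Nat.primesLE_card_eq_primeCounting]
      norm_cast
      refine (card_le_card fun b hb => ?_).trans (card_union_le _ _)
      obtain ⟨hb1, hb2⟩ := Nat.mem_primesLE.1 hb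
      have hab : a * b ≤ q := by
        rw [mul_comm]
        exact (Nat.le_div_iff_mul_le hap.pos).1 hb1
      rcases le_or_gt b (q / a / K) with h | h
      · exact mem_union_right _ (Nat.mem_primesLE.2 ⟨h, hb2⟩)
      · refine mem_union_left _ (mem_filter.2 ⟨Nat.mem_primesLE.2 ⟨?_, hb2⟩, ha4, ?_, ha3, hab, ?_⟩)
        · exact hb1.trans (Nat.div_le_self _ _)
        all_goals
          rw [Nat.div_div_eq_div_mul, Nat.div_lt_iff_lt_mul (by positivity [hap.pos])] at h
        · have h3 : q ^ 3 < b ^ 3 * (q * q) :=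
            calc q ^ 3 < (b * (a * K)) ^ 3 := Nat.pow_lt_pow_left h (by norm_num)
              _ = b ^ 3 * (a ^ 3 * K ^ 3) := by ring
              _ ≤ b ^ 3 * (q * q) := Nat.mul_le_mul le_rfl (Nat.mul_le_mul ha3 hqK)
          have h4 : q < b ^ 3 := by
            by_contra! h5
            have h6 : b ^ 3 * (q * q) ≤ q * (q * q) := Nat.mul_le_mul h5 le_rfl
            have h7 : q ^ 3 = q * (q * q) := by ring
            omega
          exact h4.trans_le (Nat.pow_le_pow_right hb2.pos (by norm_num))
        · calc q < b * (a * K) := h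
            _ = _ := by ring
    refine le_trans ?_ (h1.trans h2)
    have hda : (1 : ℝ) < (q / a : ℕ) := by
      exact_mod_cast hap.one_lt.trans_le hdiv
    have h3 : (q : ℝ) / a / 2 ≤ (q / a : ℕ) := by
      have := div_sub_one_lt_natCast_div q a
      linarith
    have h4 : Real.log (q / a : ℕ) ≤ Real.log q :=
      Real.log_le_log (by linarith) (by exact_mod_cast Nat.div_le_self _ _)
    have h5 := Real.log_pos hda
    calc (q : ℝ) / Real.log q / 16 * (a : ℝ)⁻¹ = (q / a / 2) / (8 * Real.log q) := by
          field_simp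
          norm_num
      _ ≤ _ := by gcongr
  calc (q : ℝ) / Real.log q / 128 = q / Real.log q / 16 * (1 / 8) := by ring
    _ ≤ q / Real.log q / 16 * ∑ a ∈ Nat.primesLE q with a ^ 3 ≤ q ∧ q < a ^ 4, (a : ℝ)⁻¹ := by
      gcongr
    _ ≤ ∑ a ∈ Nat.primesLE q with a ^ 3 ≤ q ∧ q < a ^ 4, (#{b ∈ Nat.primesLE q |
        q < a ^ 4 ∧ q < b ^ 4 ∧ a ^ 3 ≤ q ∧ a * b ≤ q ∧ q < K * (a * b)} : ℝ) := by
      rw [mul_sum]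
      exact sum_le_sum hterm
    _ ≤ ∑ a ∈ Nat.primesLE q, (#{b ∈ Nat.primesLE q |
        q < a ^ 4 ∧ q < b ^ 4 ∧ a ^ 3 ≤ q ∧ a * b ≤ q ∧ q < K * (a * b)} : ℝ) :=
      sum_le_sum_of_subset_of_nonneg (filter_subset _ _) fun _ _ _ => Nat.cast_nonneg _
    _ = _ := by
      rw [card_filter, sum_product, Nat.cast_sum]
      simp only [card_filter]

lemma exists_card_semiprimePairs_ge :
    ∃ K q₀ : ℕ, 2 ≤ K ∧ ∃ η : ℝ, 0 < η ∧ ∀ (P : ℕ → Prop) [DecidablePred P], ∀ q ≥ q₀,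
      ∑ r ∈ Nat.primesLE (q - 1) with P r, (r : ℝ)⁻¹ ≤ η →
        (q : ℝ) / Real.log q / 256 ≤ #(semiprimePairs P K q) := by
  obtain ⟨K, q₀, hK, hcard⟩ := exists_card_prime_pairs_ge
  obtain ⟨C, hC0, hC⟩ := exists_card_prime_pairs_mem_le
  refine ⟨K, q₀, hK, 1 / (512 * C), by positivity, fun P _ q hq hη => ?_⟩
  obtain ⟨R, hR⟩ : ∃ R, R = {r ∈ Nat.primesLE (q - 1) | P r} := ⟨_, rfl⟩
  have hbad := hC R q fun r hr => by
    rw [hR] at hr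
    exact (Nat.mem_primesLE.1 (mem_filter.1 hr).1).2.pos
  have hall := hcard q hq
  have hsub : {v ∈ Nat.primesLE q ×ˢ Nat.primesLE q |
      q < v.1 ^ 4 ∧ q < v.2 ^ 4 ∧ v.1 ^ 3 ≤ q ∧ v.1 * v.2 ≤ q ∧ q < K * (v.1 * v.2)} ⊆
      semiprimePairs P K q ∪
        ({v ∈ R ×ˢ Nat.primesLE q | q < v.2 ^ 4 ∧ v.1 * v.2 ≤ q} ∪
        ({v ∈ R ×ˢ Nat.primesLE q | q < v.2 ^ 4 ∧ v.1 * v.2 ≤ q}).image Prod.swap) := by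
    intro v hv
    obtain ⟨hv1, hv2⟩ := mem_filter.1 hv
    obtain ⟨ha, hb⟩ := mem_product.1 hv1
    have hap := (Nat.mem_primesLE.1 ha).2
    have hbp := (Nat.mem_primesLE.1 hb).2
    obtain ⟨h1, h2, h3, h4, h5⟩ := hv2
    have ha2 : v.1 * 2 ≤ v.1 * v.2 := Nat.mul_le_mul le_rfl hbp.two_le
    have hb2 : 2 * v.2 ≤ v.1 * v.2 := Nat.mul_le_mul hap.two_le le_rfl
    have := hap.pos
    have := hbp.pos
    by_cases hP1 : P v.1
    · refine mem_union_right _ (mem_union_left _ (mem_filter.2 ⟨mem_product.2 ⟨?_, hb⟩, h2, h4⟩))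
      rw [hR]
      exact mem_filter.2 ⟨Nat.mem_primesLE.2 ⟨by omega, hap⟩, hP1⟩
    by_cases hP2 : P v.2
    · refine mem_union_right _ (mem_union_right _ (mem_image.2 ⟨v.swap, mem_filter.2
        ⟨mem_product.2 ⟨?_, ha⟩, h1, ?_⟩, Prod.swap_swap v⟩))
      · rw [hR]
        exact mem_filter.2 ⟨Nat.mem_primesLE.2 ⟨by dsimp; omega, hbp⟩, hP2⟩
      · rw [mul_comm]
        exact h4
    · exact mem_union_left _ (mem_filter.2 ⟨hv1, ⟨hP1, hP2⟩, h1, h2, h3, h4, h5⟩)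
  have h1 := ((card_le_card hsub).trans (card_union_le _ _)).trans
    (Nat.add_le_add_left ((card_union_le _ _).trans
      (Nat.add_le_add_left card_image_le _)) _)
  have h2 : (_ : ℝ) ≤ _ := Nat.cast_le.2 h1
  push_cast at h2
  rw [← hR] at hη
  have hq0 : 0 ≤ (q : ℝ) / Real.log q := div_nonneg (Nat.cast_nonneg q)
    (Real.log_natCast_nonneg q)
  have h3 : C * (q / Real.log q) * ∑ r ∈ R, (r : ℝ)⁻¹ ≤ C * (q / Real.log q) * (1 / (512 * C)) := by
    gcongr
  have h4 : C * (q / Real.log q) * (1 / (512 * C)) = q / Real.log q / 512 := by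
    field_simp
  linarith

end SemiprimePairs

section PairWeight

open Finset

/-- Total weight of the pair `v` when every `q ∈ Q` spreads a unit weight uniformly over
`semiprimePairs P K q`. -/
noncomputable def pairWeight (P : ℕ → Prop) [DecidablePred P] (K : ℕ) (Q : Finset ℕ)
    (v : ℕ × ℕ) : ℝ :=
  ∑ q ∈ Q with v ∈ semiprimePairs P K q, (#(semiprimePairs P K q) : ℝ)⁻¹

variable (P : ℕ → Prop) [DecidablePred P] (K : ℕ) (Q : Finset ℕ)

lemma pairWeight_nonneg (v : ℕ × ℕ) : 0 ≤ pairWeight P K Q v :=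
  sum_nonneg fun _ _ => by positivity

lemma sum_pairWeight_mul (g : ℕ × ℕ → ℝ) :
    ∑ v ∈ Q.biUnion (semiprimePairs P K), pairWeight P K Q v * g v =
      ∑ q ∈ Q, ∑ v ∈ semiprimePairs P K q, (#(semiprimePairs P K q) : ℝ)⁻¹ * g v := by
  simp only [pairWeight, sum_mul]
  refine sum_comm' fun v q => ?_
  simp only [mem_biUnion, mem_filter]
  exact ⟨fun h => ⟨h.2.2, h.2.1⟩, fun h => ⟨⟨q, h.2, h.1⟩, h.2, h.1⟩⟩

variable {P K Q}

lemma pairWeight_le {C : ℝ} (hC0 : 0 ≤ C)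
    (hC : ∀ y : ℝ, 1 < y → (Nat.primeCounting ⌊y⌋₊ : ℝ) ≤ C * (y / Real.log y))
    (hQ : ∀ q ∈ Q, q.Prime)
    (hcard : ∀ q ∈ Q, (q : ℝ) / Real.log q / 256 ≤ #(semiprimePairs P K q)) (v : ℕ × ℕ) :
    pairWeight P K Q v ≤ 256 * (C * K) := by
  rw [pairWeight]
  obtain ⟨w, hw⟩ : ∃ w, w = v.1 * v.2 := ⟨_, rfl⟩
  rcases ({q ∈ Q | v ∈ semiprimePairs P K q}).eq_empty_or_nonempty with h | ⟨q₁, hq₁⟩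
  · rw [h, sum_empty]
    positivity
  have hmem : ∀ q ∈ ({q ∈ Q | v ∈ semiprimePairs P K q} : Finset ℕ),
      q.Prime ∧ w ≤ q ∧ q < K * w := by
    intro q hq
    obtain ⟨hq1, hq2⟩ := mem_filter.1 hq
    obtain ⟨-, -, -, -, -, h1, h2⟩ := mem_filter.1 hq2
    rw [hw]
    exact ⟨hQ q hq1, h1, h2⟩
  have hKw : 1 < K * w := (hmem q₁ hq₁).1.one_lt.trans (hmem q₁ hq₁).2.2
  have hw0 : (0 : ℝ) < w := by
    refine Nat.cast_pos.2 (Nat.pos_of_ne_zero ?_)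
    rintro rfl
    simp at hKw
  have hKwR : (1 : ℝ) < (K * w : ℕ) := by exact_mod_cast hKw
  have hlog := Real.log_pos hKwR
  have h1 : ∀ q ∈ ({q ∈ Q | v ∈ semiprimePairs P K q} : Finset ℕ),
      (#(semiprimePairs P K q) : ℝ)⁻¹ ≤ 256 * Real.log (K * w : ℕ) / w := by
    intro q hq
    obtain ⟨hqp, hwq, hqK⟩ := hmem q hq
    have hq1 : (1 : ℝ) < q := by exact_mod_cast hqp.one_lt
    have hlq := Real.log_pos hq1
    have hq0 : (0 : ℝ) < q := by linarith
    have h2 : (w : ℝ) ≤ q := by exact_mod_cast hwq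
    have h3 : Real.log q ≤ Real.log (K * w : ℕ) :=
      Real.log_le_log hq0 (by exact_mod_cast hqK.le)
    calc (#(semiprimePairs P K q) : ℝ)⁻¹ ≤ ((q : ℝ) / Real.log q / 256)⁻¹ :=
          inv_anti₀ (by positivity) (hcard q (mem_filter.1 hq).1)
      _ = 256 * Real.log q / q := by field_simp
      _ ≤ _ := by gcongr
  refine (sum_le_card_nsmul _ _ _ h1).trans ?_
  rw [nsmul_eq_mul]
  have h2 : #{q ∈ Q | v ∈ semiprimePairs P K q} ≤ Nat.primeCounting (K * w) := by
    rw [← Nat.primesLE_card_eq_primeCounting]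
    exact card_le_card fun q hq => Nat.mem_primesLE.2 ⟨(hmem q hq).2.2.le, (hmem q hq).1⟩
  have h3 := hC (K * w : ℕ) hKwR
  rw [Nat.floor_natCast] at h3
  have h4 : (#{q ∈ Q | v ∈ semiprimePairs P K q} : ℝ) ≤ Nat.primeCounting (K * w) := by
    exact_mod_cast h2
  calc _ ≤ C * ((K * w : ℕ) / Real.log (K * w : ℕ)) * (256 * Real.log (K * w : ℕ) / w) := by
        gcongr
        exact h4.trans h3
    _ = 256 * (C * K) := by
        have := hlog.ne'
        rw [Nat.cast_mul] at *
        field_simp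

lemma sum_pairWeight_div_le :
    ∑ v ∈ Q.biUnion (semiprimePairs P K), pairWeight P K Q v / (v.1 * v.2) ≤
      K * ∑ q ∈ Q, (q : ℝ)⁻¹ := by
  simp only [div_eq_mul_inv]
  rw [sum_pairWeight_mul P K Q fun v => ((v.1 : ℝ) * v.2)⁻¹, mul_sum]
  refine sum_le_sum fun q _ => ?_
  have h1 : ∀ v ∈ semiprimePairs P K q, (#(semiprimePairs P K q) : ℝ)⁻¹ * ((v.1 : ℝ) * v.2)⁻¹ ≤
      (#(semiprimePairs P K q) : ℝ)⁻¹ * (K * (q : ℝ)⁻¹) := by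
    intro v hv
    obtain ⟨hv1, -, -, -, -, h1, h2⟩ := mem_filter.1 hv
    obtain ⟨ha, hb⟩ := mem_product.1 hv1
    have ha0 : (0 : ℝ) < v.1 := Nat.cast_pos.2 (Nat.mem_primesLE.1 ha).2.pos
    have hb0 : (0 : ℝ) < v.2 := Nat.cast_pos.2 (Nat.mem_primesLE.1 hb).2.pos
    have h3 : (q : ℝ) ≤ K * (v.1 * v.2) := by exact_mod_cast h2.le
    have h4 : (v.1 : ℝ) * v.2 ≤ q := by exact_mod_cast h1
    have hq0 : (0 : ℝ) < q := (mul_pos ha0 hb0).trans_le h4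
    gcongr
    rw [inv_le_iff_one_le_mul₀ (by positivity)]
    rw [show (K : ℝ) * (q : ℝ)⁻¹ * (v.1 * v.2) = K * (v.1 * v.2) / q by ring, one_le_div hq0]
    exact h3
  refine (sum_le_card_nsmul _ _ _ h1).trans ?_
  rw [nsmul_eq_mul, ← mul_assoc]
  exact mul_le_of_le_one_left (by positivity) (mul_inv_le_one)

end PairWeight

section DensityOfNegativeValues

open Finset

lemma sum_sq_sum_prime_dvd_le (Q : Finset ℕ) (hQ : ∀ q ∈ Q, q.Prime) (N : ℕ) :
    ∑ n ∈ Icc 1 N, (∑ q ∈ Q, if q ∣ n then (1 : ℝ) else 0) ^ 2 ≤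
      N * ((∑ q ∈ Q, (q : ℝ)⁻¹) ^ 2 + ∑ q ∈ Q, (q : ℝ)⁻¹) := by
  refine (sum_sq_sum_dvd_le Q id (fun _ => 1) (fun q hq => (hQ q hq).pos) (fun _ _ => zero_le_one)
    N).trans ?_
  refine mul_le_mul_of_nonneg_left ?_ (Nat.cast_nonneg N)
  rw [pow_two, sum_mul_sum, ← sum_add_distrib]
  refine sum_le_sum fun q hq => ?_
  have h1 : ∀ r ∈ Q, (1 : ℝ) * 1 * (Nat.gcd (id q) (id r) / (id q * id r : ℕ)) ≤
      (q : ℝ)⁻¹ * (r : ℝ)⁻¹ + if q = r then (q : ℝ)⁻¹ else 0 := by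
    intro r hr
    have hq0 : (q : ℝ) ≠ 0 := Nat.cast_ne_zero.2 (hQ q hq).ne_zero
    by_cases h : q = r
    · subst h
      rw [if_pos rfl, id, Nat.gcd_self]
      push_cast
      have h2 : (1 : ℝ) * 1 * (q / (q * q)) = (q : ℝ)⁻¹ := by field_simp
      rw [h2, le_add_iff_nonneg_left]
      positivity
    · rw [if_neg h, id, id, (Nat.coprime_primes (hQ q hq) (hQ r hr)).2 h]
      push_cast
      refine le_of_eq ?_
      ring
  simp only [Nat.cast_mul] at h1
  refine (sum_le_sum h1).trans (le_of_eq ?_)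
  rw [sum_add_distrib, sum_ite_eq, if_pos hq]

lemma card_filter_mul_le {f : ℕ → ℤ} {N d q : ℕ} {s : ℤ} (hd : 0 < d) (hdq : d ≤ q)
    (hf : ∀ m, f m = s → f (d * m) = -1) :
    #{m ∈ Icc 1 (N / q) | f m = s} ≤ #{n ∈ Icc 1 N | f n = -1 ∧ d ∣ n} := by
  refine card_le_card_of_injOn (d * ·) (fun m hm => ?_)
    fun m _ n _ h => Nat.eq_of_mul_eq_mul_left hd h
  obtain ⟨hm1, hm2⟩ := mem_filter.1 hm
  obtain ⟨hm3, hm4⟩ := mem_Icc.1 hm1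
  refine mem_filter.2 ⟨mem_Icc.2 ⟨Nat.mul_pos hd hm3, ?_⟩, hf m hm2, dvd_mul_right d m⟩
  exact (Nat.mul_le_mul hdq hm4).trans (Nat.mul_div_le N q)

lemma div_le_card_add_card {f : ℕ → ℤ} {N q : ℕ}
    (hf : ∀ m, 0 < m → 2 * m ≤ N → f m = 1 ∨ f m = -1) (hq : 2 ≤ q) :
    N / q ≤ #{m ∈ Icc 1 (N / q) | f m = 1} + #{m ∈ Icc 1 (N / q) | f m = -1} := by
  conv_lhs => rw [← Nat.add_sub_cancel (n := N / q) (m := 1), ← Nat.card_Icc]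
  refine (card_le_card fun m hm => ?_).trans (card_union_le _ _)
  rw [mem_union, mem_filter, mem_filter]
  obtain ⟨hm1, hm2⟩ := mem_Icc.1 hm
  have h : 2 * m ≤ N := (Nat.mul_le_mul hq hm2).trans (Nat.mul_div_le N q)
  exact (hf m hm1 h).imp (fun h => ⟨hm, h⟩) fun h => ⟨hm, h⟩

/-- Every prime `q` with `f q = -1` yields about `N / q` solutions of `f n = -1`, counted with
weights. -/
lemma sum_inv_le_sum_weights {f : ℕ → ℤ} (hmul : ∀ m n, f (m * n) = f m * f n) {N K : ℕ}
    (hf : ∀ m, 0 < m → 2 * m ≤ N → f m = 1 ∨ f m = -1) {Q : Finset ℕ}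
    (hQ : ∀ q ∈ Q, q.Prime ∧ q ≤ N ∧ f q = -1 ∧
      (semiprimePairs (fun r => f r = -1) K q).Nonempty) :
    N / 2 * ∑ q ∈ Q, (q : ℝ)⁻¹ ≤ ∑ n ∈ Icc 1 N with f n = -1,
      ((∑ q ∈ Q, if q ∣ n then (1 : ℝ) else 0) +
        ∑ v ∈ Q.biUnion (semiprimePairs (fun r => f r = -1) K),
          if v.1 * v.2 ∣ n then pairWeight (fun r => f r = -1) K Q v else 0) := by
  have hcard : ∀ d : ℕ, (∑ n ∈ Icc 1 N with f n = -1, if d ∣ n then (1 : ℝ) else 0) =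
      #{n ∈ Icc 1 N | f n = -1 ∧ d ∣ n} := by
    intro d
    rw [← filter_filter, card_filter, Nat.cast_sum]
    simp
  have h1 : (∑ n ∈ Icc 1 N with f n = -1, ∑ q ∈ Q, if q ∣ n then (1 : ℝ) else 0) =
      ∑ q ∈ Q, (#{n ∈ Icc 1 N | f n = -1 ∧ q ∣ n} : ℝ) := by
    rw [sum_comm]
    exact sum_congr rfl fun q _ => hcard q
  have h2 : (∑ n ∈ Icc 1 N with f n = -1,
      ∑ v ∈ Q.biUnion (semiprimePairs (fun r => f r = -1) K),
        if v.1 * v.2 ∣ n then pairWeight (fun r => f r = -1) K Q v else 0) =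
      ∑ q ∈ Q, ∑ v ∈ semiprimePairs (fun r => f r = -1) K q,
        (#(semiprimePairs (fun r => f r = -1) K q) : ℝ)⁻¹ *
          (#{n ∈ Icc 1 N | f n = -1 ∧ v.1 * v.2 ∣ n} : ℝ) := by
    rw [sum_comm, ← sum_pairWeight_mul]
    refine sum_congr rfl fun v _ => ?_
    rw [← hcard, mul_sum]
    simp
  rw [sum_add_distrib, h1, h2, ← sum_add_distrib, mul_sum]
  refine sum_le_sum fun q hq => ?_
  obtain ⟨hqp, hqN, hfq, hne⟩ := hQ q hq
  have hq0 : (0 : ℝ) < q := Nat.cast_pos.2 hqp.pos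
  have h3 : #{m ∈ Icc 1 (N / q) | f m = 1} ≤ #{n ∈ Icc 1 N | f n = -1 ∧ q ∣ n} :=
    card_filter_mul_le hqp.pos le_rfl fun m hm => by rw [hmul, hfq, hm, mul_one]
  have h4 : ∀ v ∈ semiprimePairs (fun r => f r = -1) K q,
      #{m ∈ Icc 1 (N / q) | f m = -1} ≤ #{n ∈ Icc 1 N | f n = -1 ∧ v.1 * v.2 ∣ n} := by
    intro v hv
    obtain ⟨hv1, ⟨hP1, hP2⟩, -, -, -, hvq, -⟩ := mem_filter.1 hv
    obtain ⟨ha, hb⟩ := mem_product.1 hv1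
    have hap := (Nat.mem_primesLE.1 ha).2
    have hbp := (Nat.mem_primesLE.1 hb).2
    have h5 : f v.1 = 1 := (hf v.1 hap.pos (by
      calc 2 * v.1 = v.1 * 2 := mul_comm _ _
        _ ≤ v.1 * v.2 := Nat.mul_le_mul le_rfl hbp.two_le
        _ ≤ N := hvq.trans hqN)).resolve_right hP1
    have h6 : f v.2 = 1 := (hf v.2 hbp.pos
      ((Nat.mul_le_mul hap.two_le le_rfl).trans (hvq.trans hqN))).resolve_right hP2
    exact card_filter_mul_le (Nat.mul_pos hap.pos hbp.pos) hvq fun m hm => by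
      rw [hmul, hmul, h5, h6, hm]
      rfl
  have h5 := div_le_card_add_card hf hqp.two_le
  have h6 : (#{m ∈ Icc 1 (N / q) | f m = -1} : ℝ) ≤
      ∑ v ∈ semiprimePairs (fun r => f r = -1) K q,
        (#(semiprimePairs (fun r => f r = -1) K q) : ℝ)⁻¹ *
          (#{n ∈ Icc 1 N | f n = -1 ∧ v.1 * v.2 ∣ n} : ℝ) := by
    have h7 : (#(semiprimePairs (fun r => f r = -1) K q) : ℝ) ≠ 0 :=
      Nat.cast_ne_zero.2 hne.card_pos.ne'
    refine le_trans (le_of_eq ?_) (card_nsmul_le_sum _ _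
      ((#(semiprimePairs (fun r => f r = -1) K q) : ℝ)⁻¹ * #{m ∈ Icc 1 (N / q) | f m = -1})
      fun v hv => ?_)
    · rw [nsmul_eq_mul]
      field_simp
    · exact mul_le_mul_of_nonneg_left (Nat.cast_le.2 (h4 v hv)) (by positivity)
  have h7 : (N : ℝ) / 2 * (q : ℝ)⁻¹ ≤ (N / q : ℕ) := by
    have h8 := div_sub_one_lt_natCast_div N q
    have h9 : (1 : ℝ) ≤ (N / q : ℕ) := by
      exact_mod_cast (Nat.one_le_div_iff hqp.pos).2 hqN
    have h10 : (N : ℝ) / 2 * (q : ℝ)⁻¹ = N / q / 2 := by ring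
    rw [h10]
    linarith
  have h8 : ((N / q : ℕ) : ℝ) ≤ #{m ∈ Icc 1 (N / q) | f m = 1} +
      #{m ∈ Icc 1 (N / q) | f m = -1} := by exact_mod_cast h5
  have h9 : (#{m ∈ Icc 1 (N / q) | f m = 1} : ℝ) ≤ #{n ∈ Icc 1 N | f n = -1 ∧ q ∣ n} := by
    exact_mod_cast h3
  linarith

end DensityOfNegativeValues

section DensityOfNegativeValues

open Finset

lemma mul_le_card_of_sum_le {S I : Finset ℕ} (hS : S ⊆ I) (g h : ℕ → ℝ) {N η A B : ℝ}
    (hN : 0 ≤ N) (hη : 0 ≤ η) (hAB : 0 < A + B) (hsum : N / 2 * η ≤ ∑ n ∈ S, (g n + h n))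
    (hg : ∑ n ∈ I, g n ^ 2 ≤ N * A) (hh : ∑ n ∈ I, h n ^ 2 ≤ N * B) :
    η ^ 2 / (8 * (A + B)) * N ≤ #S := by
  rcases hN.eq_or_lt with rfl | hN
  · simp
  have h1 : (∑ n ∈ S, (g n + h n)) ^ 2 ≤ #S * ∑ n ∈ S, (g n + h n) ^ 2 :=
    sq_sum_le_card_mul_sum_sq
  have h2 : ∑ n ∈ S, (g n + h n) ^ 2 ≤ 2 * (N * A + N * B) :=
    calc ∑ n ∈ S, (g n + h n) ^ 2 ≤ ∑ n ∈ I, (g n + h n) ^ 2 :=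
          sum_le_sum_of_subset_of_nonneg hS fun _ _ _ => sq_nonneg _
      _ ≤ ∑ n ∈ I, 2 * (g n ^ 2 + h n ^ 2) := sum_le_sum fun n _ => add_sq_le
      _ = 2 * (∑ n ∈ I, g n ^ 2 + ∑ n ∈ I, h n ^ 2) := by rw [← mul_sum, sum_add_distrib]
      _ ≤ _ := by linarith
  have h3 : (N / 2 * η) ^ 2 ≤ #S * (2 * (N * A + N * B)) :=
    calc (N / 2 * η) ^ 2 ≤ (∑ n ∈ S, (g n + h n)) ^ 2 :=
          pow_le_pow_left₀ (by positivity) hsum 2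
      _ ≤ _ := h1.trans (mul_le_mul_of_nonneg_left h2 (Nat.cast_nonneg _))
  rw [div_mul_eq_mul_div, div_le_iff₀ (by positivity)]
  refine le_of_mul_le_mul_right ?_ (show 0 < N / 4 by positivity)
  calc η ^ 2 * N * (N / 4) = (N / 2 * η) ^ 2 := by ring
    _ ≤ _ := h3
    _ = _ := by ring

/-- A single small prime with `f q = -1` already produces a positive proportion. -/
lemma div_le_card_of_small {f : ℕ → ℤ} (hmul : ∀ m n, f (m * n) = f m * f n) {N q : ℕ}
    (hf : ∀ m, 0 < m → 2 * m ≤ N → f m = 1 ∨ f m = -1) (hq2 : 2 ≤ q) (hqN : q ≤ N)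
    (hfq : f q = -1) : 1 / (4 * q) * (N : ℝ) ≤ #{n ∈ Icc 1 N | f n = -1} := by
  have hq0 : 0 < q := by omega
  have h1 : #{m ∈ Icc 1 (N / q) | f m = 1} ≤ #{n ∈ Icc 1 N | f n = -1} :=
    (card_filter_mul_le hq0 le_rfl fun m hm => by rw [hmul, hfq, hm, mul_one]).trans
      (card_le_card fun n hn => by
        obtain ⟨hn1, hn2, -⟩ := mem_filter.1 hn
        exact mem_filter.2 ⟨hn1, hn2⟩)
  have h2 : #{m ∈ Icc 1 (N / q) | f m = -1} ≤ #{n ∈ Icc 1 N | f n = -1} :=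
    card_le_card fun n hn => by
      obtain ⟨hn1, hn2⟩ := mem_filter.1 hn
      obtain ⟨hn3, hn4⟩ := mem_Icc.1 hn1
      exact mem_filter.2 ⟨mem_Icc.2 ⟨hn3, hn4.trans (Nat.div_le_self _ _)⟩, hn2⟩
  have h3 := div_le_card_add_card hf hq2
  have h4 := div_sub_one_lt_natCast_div N q
  have h5 : (1 : ℝ) ≤ (N / q : ℕ) := by exact_mod_cast (Nat.one_le_div_iff hq0).2 hqN
  have h6 : N / q ≤ 2 * #{n ∈ Icc 1 N | f n = -1} := by omega
  replace h6 := Nat.cast_le (α := ℝ).2 h6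
  rw [Nat.cast_mul, Nat.cast_two] at h6
  have h7 : 1 / (4 * q) * (N : ℝ) = N / q / 4 := by ring
  rw [h7]
  linarith

/-- If the mass `∑ 1 / q` over `s` reaches `η`, some truncation of `s` has mass between `η` and
`η + 1`, the mass before the truncation point being smaller than `η`. -/
lemma exists_truncation (P : ℕ → Prop) [DecidablePred P] {N : ℕ} {η : ℝ} (hη : 0 < η)
    (hN : η ≤ ∑ q ∈ Nat.primesLE N with P q, (q : ℝ)⁻¹) :
    ∃ z ≤ N, η ≤ ∑ q ∈ Nat.primesLE z with P q, (q : ℝ)⁻¹ ∧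
      ∑ q ∈ Nat.primesLE z with P q, (q : ℝ)⁻¹ ≤ η + 1 ∧
      ∀ q ≤ z, ∑ r ∈ Nat.primesLE (q - 1) with P r, (r : ℝ)⁻¹ ≤ η := by
  classical
  have hex : ∃ z, η ≤ ∑ q ∈ Nat.primesLE z with P q, (q : ℝ)⁻¹ := ⟨N, hN⟩
  obtain ⟨z, hz⟩ : ∃ z, z = Nat.find hex := ⟨_, rfl⟩
  have hz1 : η ≤ ∑ q ∈ Nat.primesLE z with P q, (q : ℝ)⁻¹ := hz ▸ Nat.find_spec hex
  have hz0 : 0 < z := by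
    rcases Nat.eq_zero_or_pos z with h | h
    · subst h
      rw [sum_eq_zero] at hz1
      · linarith
      · intro q hq
        obtain ⟨h1, h2⟩ := Nat.mem_primesLE.1 (mem_filter.1 hq).1
        exact absurd h2.pos (by omega)
    · exact h
  have hlt : ∑ q ∈ Nat.primesLE (z - 1) with P q, (q : ℝ)⁻¹ < η :=
    not_le.1 (Nat.find_min hex (by omega))
  refine ⟨z, hz ▸ Nat.find_min' hex hN, hz1, ?_, fun q hq => ?_⟩
  · have hsub : {q ∈ Nat.primesLE z | P q} ⊆ insert z {q ∈ Nat.primesLE (z - 1) | P q} := by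
      intro q hq
      obtain ⟨h1, h2⟩ := mem_filter.1 hq
      obtain ⟨h3, h4⟩ := Nat.mem_primesLE.1 h1
      rcases h3.eq_or_lt with h | h
      · exact mem_insert.2 (Or.inl h)
      · exact mem_insert_of_mem (mem_filter.2 ⟨Nat.mem_primesLE.2 ⟨by omega, h4⟩, h2⟩)
    refine (sum_le_sum_of_subset_of_nonneg hsub fun _ _ _ => by positivity).trans ?_
    rw [sum_insert]
    · have : (z : ℝ)⁻¹ ≤ 1 := Nat.cast_inv_le_one z
      linarith
    · intro h
      have := (Nat.mem_primesLE.1 (mem_filter.1 h).1).1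
      omega
  · refine (sum_le_sum_of_subset_of_nonneg (fun r hr => ?_) fun _ _ _ => by positivity).trans
      hlt.le
    obtain ⟨h1, h2⟩ := mem_filter.1 hr
    obtain ⟨h3, h4⟩ := Nat.mem_primesLE.1 h1
    exact mem_filter.2 ⟨Nat.mem_primesLE.2 ⟨by omega, h4⟩, h2⟩

/-- A completely multiplicative function with values `±1` takes the value `-1` with positive density
as soon as the primes where it does have reciprocal mass bounded below. -/
theorem exists_density_of_sum_inv_primes_ge {c : ℝ} (hc : 0 < c) :
    ∃ δ : ℝ, 0 < δ ∧ ∀ (f : ℕ → ℤ) (N : ℕ), (∀ m n, f (m * n) = f m * f n) →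
      (∀ m, 0 < m → 2 * m ≤ N → f m = 1 ∨ f m = -1) →
      c ≤ ∑ q ∈ Nat.primesLE N with f q = -1, (q : ℝ)⁻¹ →
      δ * (N : ℝ) ≤ #{n ∈ Icc 1 N | f n = -1} := by
  obtain ⟨K, q₀, hK, η₀, hη₀, hcard⟩ := exists_card_semiprimePairs_ge
  obtain ⟨C₁, hC₁0, hC₁⟩ := exists_primeCounting_floor_le
  obtain ⟨C₃, hC₃0, hC₃⟩ := exists_sum_inv_primes_window_le
  obtain ⟨η, hη⟩ : ∃ η, η = min c η₀ := ⟨_, rfl⟩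
  have hη0 : 0 < η := hη ▸ lt_min hc hη₀
  obtain ⟨K₀, hK₀⟩ : ∃ K₀, K₀ = q₀ + K ^ 4 := ⟨_, rfl⟩
  have hK₀0 : 0 < K₀ := by
    have : 0 < K ^ 4 := by positivity
    omega
  obtain ⟨A, hA⟩ : ∃ A, A = (η + 1) ^ 2 + (η + 1) := ⟨_, rfl⟩
  obtain ⟨M, hM⟩ : ∃ M, M = K * (η + 1) := ⟨_, rfl⟩
  obtain ⟨C, hC⟩ : ∃ C, C = 256 * (C₁ * K) := ⟨_, rfl⟩
  obtain ⟨B, hB⟩ : ∃ B, B = M * (M + 4 * C * C₃ + C) := ⟨_, rfl⟩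
  have hA0 : 0 < A := by
    rw [hA]
    positivity
  have hB0 : 0 ≤ B := by
    rw [hB, hM, hC]
    positivity
  refine ⟨min (1 / (4 * K₀)) (η ^ 2 / (8 * (A + B))),
    lt_min (by positivity) (by positivity), fun f N hmul hf hmass => ?_⟩
  by_cases hsmall : ∃ q ∈ Nat.primesLE N, f q = -1 ∧ q ≤ K₀
  · obtain ⟨q, hq, hfq, hqK⟩ := hsmall
    obtain ⟨hqN, hqp⟩ := Nat.mem_primesLE.1 hq
    refine le_trans ?_ (div_le_card_of_small hmul hf hqp.two_le hqN hfq)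
    refine mul_le_mul_of_nonneg_right ((min_le_left _ _).trans ?_) (Nat.cast_nonneg N)
    have hq0 : (0 : ℝ) < q := Nat.cast_pos.2 hqp.pos
    have hqK' : (q : ℝ) ≤ K₀ := Nat.cast_le.2 hqK
    gcongr
  push Not at hsmall
  refine (mul_le_mul_of_nonneg_right (min_le_right _ _) (Nat.cast_nonneg N)).trans ?_
  obtain ⟨z, hzN, hz1, hz2, hz3⟩ := exists_truncation (fun q => f q = -1) hη0
    ((hη ▸ min_le_left c η₀ : η ≤ c).trans hmass)
  obtain ⟨Q, hQ⟩ : ∃ Q, Q = {q ∈ Nat.primesLE z | f q = -1} := ⟨_, rfl⟩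
  rw [← hQ] at hz1 hz2
  have hQmem : ∀ q ∈ Q, q.Prime ∧ q ≤ z ∧ f q = -1 ∧ K₀ < q := by
    intro q hq
    rw [hQ] at hq
    obtain ⟨h1, h2⟩ := mem_filter.1 hq
    obtain ⟨h3, h4⟩ := Nat.mem_primesLE.1 h1
    exact ⟨h4, h3, h2, hsmall q (Nat.mem_primesLE.2 ⟨h3.trans hzN, h4⟩) h2⟩
  have hQcard : ∀ q ∈ Q, (q : ℝ) / Real.log q / 256 ≤
      #(semiprimePairs (fun r => f r = -1) K q) := by
    intro q hq
    obtain ⟨h1, h2, h3, h4⟩ := hQmem q hq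
    exact hcard _ q (by omega) ((hz3 q h2).trans (hη ▸ min_le_right c η₀))
  refine mul_le_card_of_sum_le (filter_subset _ _)
    (fun n => ∑ q ∈ Q, if q ∣ n then (1 : ℝ) else 0)
    (fun n => ∑ v ∈ Q.biUnion (semiprimePairs (fun r => f r = -1) K),
      if v.1 * v.2 ∣ n then pairWeight (fun r => f r = -1) K Q v else 0)
    (Nat.cast_nonneg N) hη0.le (by positivity) ?_ ?_ ?_
  · refine le_trans ?_ (sum_inv_le_sum_weights hmul hf fun q hq => ?_)
    · gcongr
    · obtain ⟨h1, h2, h3, h4⟩ := hQmem q hq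
      refine ⟨h1, h2.trans hzN, h3, card_pos.1 ?_⟩
      have h5 : (1 : ℝ) < q := by exact_mod_cast h1.one_lt
      have h6 := Real.log_pos h5
      have h7 : (0 : ℝ) < #(semiprimePairs (fun r => f r = -1) K q) :=
        lt_of_lt_of_le (by positivity) (hQcard q hq)
      exact_mod_cast h7
  · refine (sum_sq_sum_prime_dvd_le Q (fun q hq => (hQmem q hq).1) N).trans ?_
    rw [hA]
    gcongr
  · rw [hB]
    refine sum_sq_sum_semiprime_dvd_le hC₃ _ (fun v hv => ?_) _ (pairWeight_nonneg _ K Q)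
      (fun v => ?_) ?_ N
    · obtain ⟨q, hq, hv⟩ := mem_biUnion.1 hv
      have h1 := (mem_product.1 (mem_filter.1 hv).1)
      refine ⟨(Nat.mem_primesLE.1 h1.1).2, (Nat.mem_primesLE.1 h1.2).2,
        lt_and_lt_pow_of_mem_semiprimePairs ?_ hv⟩
      have := (hQmem q hq).2.2.2
      omega
    · rw [hC]
      exact pairWeight_le hC₁0.le hC₁ (fun q hq => (hQmem q hq).1) hQcard v
    · rw [hM]
      refine sum_pairWeight_div_le.trans ?_
      gcongr

end DensityOfNegativeValues

section DensityOfNonresidues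

open Finset Filter

lemma exists_prime_dvd_legendreSym_eq_neg_one (p : ℕ) [Fact p.Prime] {n : ℕ}
    (hn : legendreSym p n = -1) : ∃ q : ℕ, q.Prime ∧ q ∣ n ∧ legendreSym p q = -1 := by
  induction n using Nat.strong_induction_on with
  | _ n ih =>
    have hn1 : n ≠ 1 := by
      rintro rfl
      rw [Nat.cast_one, legendreSym.at_one] at hn
      omega
    have hn0 : n ≠ 0 := by
      rintro rfl
      rw [Nat.cast_zero, legendreSym.at_zero] at hn
      omega
    obtain ⟨q, hq, k, rfl⟩ := Nat.exists_prime_and_dvd hn1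
    have hk0 : k ≠ 0 := right_ne_zero_of_mul hn0
    rw [Nat.cast_mul, legendreSym.mul] at hn
    by_cases h : legendreSym p q = -1
    · exact ⟨q, hq, dvd_mul_right q k, h⟩
    · have hk : legendreSym p k = -1 := by
        rcases Int.eq_one_or_neg_one_of_mul_eq_neg_one hn with h1 | h1
        · rwa [h1, one_mul] at hn
        · exact absurd h1 h
      obtain ⟨r, hr, hrk, hfr⟩ := ih k
        (lt_mul_of_one_lt_left (Nat.pos_of_ne_zero hk0) hq.one_lt) hk
      exact ⟨r, hr, hrk.trans (dvd_mul_left k q), hfr⟩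

lemma card_legendreSym_eq_neg_one_le (p : ℕ) [Fact p.Prime] (x : ℕ) :
    (#{n ∈ range x | legendreSym p (n : ℕ) = -1} : ℝ) ≤
      x * ∑ q ∈ Nat.primesLE x with legendreSym p (q : ℕ) = -1, (q : ℝ)⁻¹ := by
  have hsub : {n ∈ range x | legendreSym p (n : ℕ) = -1} ⊆
      ({q ∈ Nat.primesLE x | legendreSym p (q : ℕ) = -1}).biUnion
        fun q => {n ∈ Ioc 0 x | q ∣ n} := by
    intro n hn
    obtain ⟨hn1, hn2⟩ := mem_filter.1 hn
    have hnx := mem_range.1 hn1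
    have hn0 : 0 < n := by
      rcases Nat.eq_zero_or_pos n with h | h
      · rw [h, Nat.cast_zero, legendreSym.at_zero] at hn2
        omega
      · exact h
    obtain ⟨q, hq, hqn, hfq⟩ := exists_prime_dvd_legendreSym_eq_neg_one p hn2
    exact mem_biUnion.2 ⟨q, mem_filter.2 ⟨Nat.mem_primesLE.2
      ⟨(Nat.le_of_dvd hn0 hqn).trans hnx.le, hq⟩, hfq⟩,
      mem_filter.2 ⟨mem_Ioc.2 ⟨hn0, hnx.le⟩, hqn⟩⟩
  have h1 := Nat.cast_le (α := ℝ).2 ((card_le_card hsub).trans card_biUnion_le)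
  refine h1.trans ?_
  rw [Nat.cast_sum, mul_sum]
  refine sum_le_sum fun q _ => ?_
  rw [Nat.Ioc_filter_dvd_card_eq_div, ← div_eq_mul_inv]
  exact Nat.cast_div_le

lemma legendreSym_natCast_eq_one_or_neg_one (p : ℕ) [Fact p.Prime] {n : ℕ} (hn0 : 0 < n)
    (hn : n < p) : legendreSym p (n : ℕ) = 1 ∨ legendreSym p (n : ℕ) = -1 := by
  refine legendreSym.eq_one_or_neg_one p ?_
  rw [Int.cast_natCast]
  exact natCast_ne_zero_of_lt hn0 hn

lemma sum_range_legendreSym_eq (p : ℕ) [Fact p.Prime] {x : ℕ} (hx0 : 0 < x) (hx : x ≤ p) :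
    ∑ n ∈ range x, legendreSym p (n : ℕ) =
      x - 1 - 2 * #{n ∈ range x | legendreSym p (n : ℕ) = -1} := by
  have h1 : ∀ n ∈ range x, legendreSym p (n : ℕ) =
      1 - (if n = 0 then 1 else 0) - 2 * (if legendreSym p (n : ℕ) = -1 then 1 else 0) := by
    intro n hn
    rcases Nat.eq_zero_or_pos n with rfl | h
    · simp [legendreSym.at_zero]
    · rw [if_neg h.ne']
      rcases legendreSym_natCast_eq_one_or_neg_one p h ((mem_range.1 hn).trans_le hx) with h | h
      · rw [h]
        simp
      · rw [h]
        simp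
  rw [sum_congr rfl h1, sum_sub_distrib, sum_sub_distrib, ← mul_sum, sum_ite_eq' (range x) 0,
    if_pos (mem_range.2 hx0), sum_boole]
  simp

lemma sum_inv_nonresidue_primes_ge (p : ℕ) [Fact p.Prime] {x : ℕ} {κ : ℝ} (hκ : 0 < κ)
    (hx : x ≤ p) (hxκ : 1 / κ ≤ x)
    (hsum : |((∑ n ∈ range x, quadraticChar (ZMod p) (n : ZMod p) : ℤ) : ℝ)| ≤ κ * x) :
    1 / 2 - κ ≤ ∑ q ∈ Nat.primesLE x with legendreSym p (q : ℕ) = -1, (q : ℝ)⁻¹ := by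
  have hxR : (0 : ℝ) < x := (by positivity : 0 < 1 / κ).trans_le hxκ
  have h1 := card_legendreSym_eq_neg_one_le p x
  have h2 : ∑ n ∈ range x, quadraticChar (ZMod p) (n : ZMod p) =
      ∑ n ∈ range x, legendreSym p (n : ℕ) := by
    simp [legendreSym]
  rw [h2, sum_range_legendreSym_eq p (Nat.cast_pos.1 hxR) hx] at hsum
  have h3 := (abs_le.1 hsum).2
  push_cast at h3
  rw [div_le_iff₀ hκ] at hxκ
  refine le_of_mul_le_mul_left ?_ hxR
  linarith

lemma eventually_sum_inv_nonresidue_primes_ge {η κ : ℝ} (hη : 0 < η) (hη1 : η ≤ 1 / 100)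
    (hκ : 0 < κ) : ∀ᶠ p : ℕ in atTop, ∀ _ : Fact p.Prime,
      1 / 2 - κ ≤ ∑ q ∈ Nat.primesLE ⌊(p : ℝ) ^ (1 / 4 + η)⌋₊ with
        legendreSym p (q : ℕ) = -1, (q : ℝ)⁻¹ := by
  have hlim : Tendsto (fun p : ℕ => ⌊(p : ℝ) ^ (1 / 4 + η)⌋₊) atTop atTop :=
    tendsto_nat_floor_atTop.comp
      ((tendsto_rpow_atTop (by positivity)).comp tendsto_natCast_atTop_atTop)
  filter_upwards [eventually_abs_sum_range_quadraticChar_le hη hη1 hκ,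
    (tendsto_natCast_atTop_atTop (R := ℝ).comp hlim).eventually_ge_atTop (1 / κ),
    eventually_ge_atTop 1] with p h1 h2 h3 hp
  refine sum_inv_nonresidue_primes_ge p hκ ?_ h2 (h1 hp)
  have hp1 : (1 : ℝ) ≤ p := by exact_mod_cast h3
  refine Nat.floor_le_of_le ?_
  calc (p : ℝ) ^ (1 / 4 + η) ≤ (p : ℝ) ^ (1 : ℝ) :=
        Real.rpow_le_rpow_of_exponent_le hp1 (by linarith)
    _ = p := Real.rpow_one _

lemma exists_eventually_sum_inv_nonresidue_primes_ge {ε : ℝ} (hε : 0 < ε) :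
    ∃ c : ℝ, 0 < c ∧ ∀ᶠ p : ℕ in atTop, ∀ _ : Fact p.Prime, ∀ N : ℕ,
      (p : ℝ) ^ (1 / (4 * √(Real.exp 1)) + ε) ≤ N →
        c ≤ ∑ q ∈ Nat.primesLE N with legendreSym p (q : ℕ) = -1, (q : ℝ)⁻¹ := by
  obtain ⟨C, hC0, hC⟩ := exists_sum_inv_primes_le
  obtain ⟨s, hs⟩ : ∃ s, s = √(Real.exp 1) := ⟨_, rfl⟩
  have hs' : s = Real.exp (1 / 2) := by rw [hs, Real.exp_half]
  have hs1 : 1 < s := hs' ▸ Real.one_lt_exp_iff.2 (by norm_num)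
  obtain ⟨η, hη⟩ : ∃ η, η = min ε (1 / 100) := ⟨_, rfl⟩
  have hη0 : 0 < η := hη ▸ lt_min hε (by norm_num)
  have hηε : η ≤ ε := hη ▸ min_le_left _ _
  have hη1 : η ≤ 1 / 100 := hη ▸ min_le_right _ _
  rw [← hs]
  obtain ⟨a, ha⟩ : ∃ a, a = 1 / (4 * s) + ε := ⟨_, rfl⟩
  have ha0 : 0 < a := by
    rw [ha]
    positivity
  obtain ⟨l, hl⟩ : ∃ l, l = Real.log ((1 / 4 + η) / a) := ⟨_, rfl⟩
  have hl2 : l < 1 / 2 := by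
    rw [hl, Real.log_lt_iff_lt_exp (by positivity), ← hs', div_lt_iff₀ ha0, ha]
    have h1 : s * (1 / (4 * s) + ε) = 1 / 4 + s * ε := by field_simp
    rw [h1]
    nlinarith
  obtain ⟨c, hc⟩ : ∃ c, c = min ((1 / 2 - l) / 4) (1 / 4) := ⟨_, rfl⟩
  have hc0 : 0 < c := hc ▸ lt_min (by linarith) (by norm_num)
  have hcl : c ≤ (1 / 2 - l) / 4 := hc ▸ min_le_left _ _
  have hc4 : c ≤ 1 / 4 := hc ▸ min_le_right _ _
  rw [← ha]
  have hlim : Tendsto (fun n : ℕ => Real.log n) atTop atTop :=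
    Real.tendsto_log_atTop.comp tendsto_natCast_atTop_atTop
  refine ⟨c, hc0, ?_⟩
  filter_upwards [eventually_sum_inv_nonresidue_primes_ge hη0 hη1 hc0,
    hlim.eventually_ge_atTop (C / (c * a)), eventually_ge_atTop 2] with p h1 h2 h3 hp N hN
  have hmass := h1 hp
  obtain ⟨x, hx⟩ : ∃ x, x = ⌊(p : ℝ) ^ (1 / 4 + η)⌋₊ := ⟨_, rfl⟩
  rw [← hx] at hmass
  have hp1 : (1 : ℝ) < p := by exact_mod_cast h3
  have hlp := Real.log_pos hp1
  have hN1 : (1 : ℝ) < N := (Real.one_lt_rpow hp1 ha0).trans_le hN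
  have hlN : a * Real.log p ≤ Real.log N := by
    rw [← Real.log_rpow (by linarith)]
    exact Real.log_le_log (by positivity) hN
  have hsplit : ∑ q ∈ Nat.primesLE x with legendreSym p (q : ℕ) = -1, (q : ℝ)⁻¹ ≤
      ∑ q ∈ Nat.primesLE N with legendreSym p (q : ℕ) = -1, (q : ℝ)⁻¹ +
        ∑ q ∈ Nat.primesLE x with N < q, (q : ℝ)⁻¹ := by
    refine (sum_le_sum_of_subset_of_nonneg (t := {q ∈ Nat.primesLE N |
      legendreSym p (q : ℕ) = -1} ∪ {q ∈ Nat.primesLE x | N < q}) (fun q hq => ?_)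
      fun _ _ _ => by positivity).trans ?_
    swap
    · rw [← sum_union_inter]
      exact le_add_of_nonneg_right (sum_nonneg fun _ _ => by positivity)
    obtain ⟨hq1, hq2⟩ := mem_filter.1 hq
    rcases le_or_gt q N with h | h
    · exact mem_union_left _ (mem_filter.2
        ⟨Nat.mem_primesLE.2 ⟨h, (Nat.mem_primesLE.1 hq1).2⟩, hq2⟩)
    · exact mem_union_right _ (mem_filter.2 ⟨hq1, h⟩)
  rcases lt_or_ge x N with hxN | hxN
  · have h4 : ∑ q ∈ Nat.primesLE x with N < q, (q : ℝ)⁻¹ = 0 := by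
      rw [filter_eq_empty_iff.2, sum_empty]
      intro q hq
      have := (Nat.mem_primesLE.1 hq).1
      omega
    linarith
  · have h4 := hC N x (by exact_mod_cast hN1) hxN
    have hlN0 : 0 < Real.log N := Real.log_pos hN1
    have hx0 : (1 : ℝ) < x := hN1.trans_le (Nat.cast_le.2 hxN)
    have hlx0 : 0 < Real.log x := Real.log_pos hx0
    have hlx : Real.log x ≤ (1 / 4 + η) * Real.log p := by
      rw [← Real.log_rpow (by linarith)]
      refine Real.log_le_log (by linarith) ?_
      rw [hx]
      exact Nat.floor_le (by positivity)
    have h5 : Real.log (Real.log x) - Real.log (Real.log N) ≤ l := by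
      rw [hl, ← Real.log_div hlx0.ne' hlN0.ne']
      refine Real.log_le_log (by positivity) ?_
      calc Real.log x / Real.log N ≤ (1 / 4 + η) * Real.log p / (a * Real.log p) := by gcongr
        _ = _ := by field_simp
    have h6 : C / Real.log N ≤ c := by
      rw [div_le_iff₀ hlN0]
      rw [div_le_iff₀ (by positivity)] at h2
      calc C ≤ c * (a * Real.log p) := by linarith
        _ ≤ _ := by gcongr
    linarith

end DensityOfNonresidues

/-- For every ε > 0 there exists δ > 0 such that, for all sufficiently large primes p,
for every integer N with p^{1/(4√e) + ε} ≤ N ≤ p, the number of integers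
1 ≤ n ≤ N with (n|p) = −1 is at least δN. -/
theorem density_nonresidues_count
    (ε : ℝ) (hε : 0 < ε) :
    ∃ δ : ℝ, 0 < δ ∧ ∃ p₀ : ℕ, ∀ p : ℕ, p₀ ≤ p → ∀ hp : p.Prime,
      ∀ N : ℕ, (p : ℝ) ^ (1 / (4 * Real.sqrt (Real.exp 1)) + ε) ≤ (N : ℝ) →
        N ≤ p →
        δ * (N : ℝ) ≤
          (((Finset.Icc 1 N).filter
            (fun n : ℕ => @legendreSym p ⟨hp⟩ (n : ℤ) = -1)).card : ℝ) := by
  obtain ⟨c, hc, hmass⟩ := exists_eventually_sum_inv_nonresidue_primes_ge hε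
  obtain ⟨p₀, hp₀⟩ := Filter.eventually_atTop.1 hmass
  obtain ⟨δ, hδ, hdens⟩ := exists_density_of_sum_inv_primes_ge hc
  refine ⟨δ, hδ, p₀, fun p hp hprime N hN hNp => ?_⟩
  have : Fact p.Prime := ⟨hprime⟩
  refine hdens (fun n => legendreSym p n) N (fun m n => ?_) (fun m hm0 hm => ?_)
    (hp₀ p hp ⟨hprime⟩ N hN)
  · rw [Nat.cast_mul, legendreSym.mul]
  · exact legendreSym_natCast_eq_one_or_neg_one p hm0 (by omega)
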